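/- arXiv:1302.3060 — 5 statements merged into one kernel-verified Lean document; each statement's English description precedes it below -/
import Mathlib

section
/- Assume either (1) χ₁, χ₂ are unramified and 0 ≤ n < q, or (2) χ₁, χ₂ are tamely ramified and n = 0; assume χ₁ ≠ ωχ₂, σ = Ind_B^G(χ₁,χ₂) is irreducible, and the Breuil–Schneider conditions |λ̃μ̃qπ^n| = 1, |λ̃| ≤ |q^{-1}π^{-n}|, |μ̃| ≤ |q^{-1}π^{-n}| hold, where λ̃ = χ₁(π)π^m and μ̃ = ω(π)χ₂(π)π^m. Let Λ = Σ_{i=0}^{n} (O_E[B](u^i ⊗ F′₀) + O_E[B](u^i ⊗ F″₀)) ⊂ K, where F′₀(x) = χ₁(x)·1_{O_F}(x) and F″₀(x) = ω(x)χ₂(x)·1_{O_F}(x) for x ∈ F∖{0}. Then there exist O_E-lattices M₀(β) ⊂ V_τ (β ∈ W) such that every φ ∈ Λ vanishing identically outside O_F admits an expansion φ(x) = Σ_{l=l₀}^{∞} Σ_{β∈W} C_l(β) ψ_β(π^{-l}x) φ_l(x) with C_l(β) ∈ V_τ, finitely many nonzero for each l, and C₀(β) ∈ M₀(β) for every β ∈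 W. -/
open scoped Classical
open Matrix

noncomputable section

namespace BS

variable (E : Type) [Field E]

/-- The ring of integers of a subfield `F` of `E`, with respect to a nonarchimedean
absolute value on `E`, as an additive subgroup of `F`. -/
def OFadd (abs : AbsoluteValue E ℝ)
    (na : ∀ x y : E, abs (x + y) ≤ max (abs x) (abs y))
    (F : Subfield E) : AddSubgroup F where
  carrier := {x | abs (x : E) ≤ 1}
  zero_mem' := by simp
  add_mem' := by
    intro a b ha hb
    simp only [Set.mem_setOf_eq] at *
    have h : ((a + b : F) : E) = (a : E) + (b : E) := by push_cast; ring
    rw [h]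
    exact le_trans (na _ _) (max_le ha hb)
  neg_mem' := by
    intro a ha
    simp only [Set.mem_setOf_eq] at *
    have h : ((-a : F) : E) = -(a : E) := by push_cast; ring
    rw [h, abs.map_neg]
    exact ha

/-- `W = F/O_F`. -/
abbrev Wq (abs : AbsoluteValue E ℝ)
    (na : ∀ x y : E, abs (x + y) ≤ max (abs x) (abs y))
    (F : Subfield E) : Type := F ⧸ OFadd E abs na F

/-- The canonical projection `F → W = F/O_F`. -/
def mkW (abs : AbsoluteValue E ℝ)
    (na : ∀ x y : E, abs (x + y) ≤ max (abs x) (abs y))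
    (F : Subfield E) : F →+ Wq E abs na F := QuotientAddGroup.mk' _

/-- Multiplication by `π` on `W = F/O_F`. -/
def pmulW (abs : AbsoluteValue E ℝ)
    (na : ∀ x y : E, abs (x + y) ≤ max (abs x) (abs y))
    (F : Subfield E) (π : F) (hπ : abs (π : E) ≤ 1) :
    Wq E abs na F →+ Wq E abs na F :=
  QuotientAddGroup.map _ _ (AddMonoidHom.mulLeft π) (by
    intro x hx
    simp only [AddSubgroup.mem_comap, AddMonoidHom.coe_mulLeft]
    show abs ((π * x : F) : E) ≤ 1
    have h : ((π * x : F) : E) = (π : E) * (x : E) := by push_cast; ring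
    rw [h, abs.map_mul]
    have hx' : abs (x : E) ≤ 1 := hx
    nlinarith [abs.nonneg (x : E), abs.nonneg (π : E)])


/-- Extension of a character `χ : F^× → E^×` to `F`, by `0` at `0`. -/
def extChar (F : Subfield E) (χ : Fˣ →* Eˣ) (x : F) : E :=
  if h : x = 0 then 0 else (χ (Units.mk0 x h) : E)

/-- A matrix over the subfield `F`, viewed over `E`. -/
def matE (F : Subfield E) (g : Matrix (Fin 2) (Fin 2) F) : Matrix (Fin 2) (Fin 2) E :=
  fun i j => (g i j : E)

/-- The rational representation `τ = det(·)^m ⊗ Sym^n` on `V_τ = E[u]^{≤n}`, realized on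
polynomials: `τ([[a,b],[c,d]])·u^i = (ad−bc)^m (a+cu)^{n−i} (b+du)^i`. -/
def tauPoly (m : ℤ) (n : ℕ) (g : Matrix (Fin 2) (Fin 2) E) (P : Polynomial E) :
    Polynomial E :=
  ((g 0 0 * g 1 1 - g 0 1 * g 1 0) ^ m) •
    ∑ i ∈ Finset.range (n + 1), P.coeff i •
      ((Polynomial.C (g 0 0) + Polynomial.C (g 1 0) * Polynomial.X) ^ (n - i) *
       (Polynomial.C (g 0 1) + Polynomial.C (g 1 1) * Polynomial.X) ^ i)

/-- The `O_E`-span of the translates, by elements of the set `{g : G | P g}`, of elements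
of `S` — e.g. `O_E[B]·S`. -/
def OESpan (abs : AbsoluteValue E ℝ) {G V : Type} [AddCommMonoid V] [Module E V]
    (act : G → V → V) (P : G → Prop) (S : Set V) : Set V :=
  {x | ∃ (k : ℕ) (c : Fin k → E) (b : Fin k → G) (w : Fin k → V),
    (∀ i, abs (c i) ≤ 1) ∧ (∀ i, P (b i)) ∧ (∀ i, w i ∈ S) ∧
    x = ∑ i, c i • act (b i) (w i)}

/-- The action of an upper triangular matrix `g = [[a,b],[0,d]]` on the Kirillov model
`K` of `ρ = τ⊗σ`: `(ρ(g)φ)(x) = χ₁(d)χ₂(d)·τ(g)(ψ((b/d)x)·φ((a/d)x))`. -/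
def kirAct (F : Subfield E) (χ1 χ2 : Fˣ →* Eˣ) (ψ : F → E) (m : ℤ) (n : ℕ)
    (g : GL (Fin 2) F) (φ : F → Polynomial E) : F → Polynomial E :=
  fun x =>
    (extChar E F χ1 ((g : Matrix (Fin 2) (Fin 2) F) 1 1) *
      extChar E F χ2 ((g : Matrix (Fin 2) (Fin 2) F) 1 1)) •
      tauPoly E m n (matE E F (g : Matrix (Fin 2) (Fin 2) F))
        ((ψ ((((g : Matrix (Fin 2) (Fin 2) F) 0 1) /
              ((g : Matrix (Fin 2) (Fin 2) F) 1 1)) * x)) •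
          φ ((((g : Matrix (Fin 2) (Fin 2) F) 0 0) /
              ((g : Matrix (Fin 2) (Fin 2) F) 1 1)) * x))

/-- The function `F′₀ = 1_{O_F}·χ₁`. -/
def Fprime0 (abs : AbsoluteValue E ℝ) (F : Subfield E) (χ1 : Fˣ →* Eˣ) : F → E :=
  fun x => if abs (x : E) ≤ 1 then extChar E F χ1 x else 0

/-- The normalized valuation on `F` (the integer `k` with `|x| = |π|^k`). -/
def vall (abs : AbsoluteValue E ℝ) (F : Subfield E) (π : F) (x : F) : ℤ :=
  if h : ∃ k : ℤ, abs (x : E) = abs (π : E) ^ k then h.choose else 0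

/-- The unramified character `ω` of `F^×` with `ω(π) = q⁻¹` (extended by `0` at `0`). -/
def omegaFun (abs : AbsoluteValue E ℝ) (F : Subfield E) (π : F) (q : ℕ) (x : F) : E :=
  if x = 0 then 0 else (q : E) ^ (-(vall E abs F π x))

/-- The function `F″₀ = 1_{O_F}·ωχ₂`. -/
def Fsecond0 (abs : AbsoluteValue E ℝ) (F : Subfield E) (π : F) (q : ℕ)
    (χ2 : Fˣ →* Eˣ) : F → E :=
  fun x => if abs (x : E) ≤ 1 then omegaFun E abs F π q x * extChar E F χ2 x else 0

/-- The lattice `N_l(β) = {P ∈ E[u]^{≤n} : |P(u)| ≤ |π|^{-nl} for all u ∈ D_l(β)}`, where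
`D_l(β) = {u ∈ F : |u − π^{-l}b| ≤ |π^{-l}|}` for any lift `b ∈ F` of `β`. -/
def Nset (abs : AbsoluteValue E ℝ)
    (na : ∀ x y : E, abs (x + y) ≤ max (abs x) (abs y))
    (F : Subfield E) (π : F) (n : ℕ) (l : ℤ) (β : Wq E abs na F) : Set (Polynomial E) :=
  {P | P.degree ≤ (n : WithBot ℕ) ∧ ∀ b : F, mkW E abs na F b = β → ∀ u : F,
      abs ((u : E) - (π : E) ^ (-l) * (b : E)) ≤ abs ((π : E) ^ (-l)) →
      abs (Polynomial.eval (u : E) P) ≤ abs (π : E) ^ (-((n : ℤ) * l))}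

/-- `L` is an `O_E`-lattice in `V_τ = E[u]^{≤n}`: the `O_E`-span of a finite set spanning
`E[u]^{≤n}` over `E`. -/
def IsLatticeIn (abs : AbsoluteValue E ℝ) (n : ℕ) (L : Set (Polynomial E)) : Prop :=
  ∃ s : Finset (Polynomial E),
    Submodule.span E (s : Set (Polynomial E)) = Polynomial.degreeLE E (n : WithBot ℕ) ∧
    L = {v | ∃ c : Polynomial E → E, (∀ x, abs (c x) ≤ 1) ∧ v = ∑ x ∈ s, c x • x}

/-- `C : ℤ → W → V_τ` is (the family of coefficients of) an expansion
`φ(x) = Σ_{l=l₀}^∞ Σ_{β∈W} C_l(β) ψ_β(π^{-l}x) φ_l(x)`, where `φ_l` is the characteristic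
function of the annulus `π^l U_F` and, on this annulus, `ψ_β(π^{-l}x) = ψ(π^{-l}bx)` for
any lift `b` of `β` (the lift `Quotient.out β` is used; on `π^l U_F` the value does not
depend on this choice). -/
def IsExpansionOf (abs : AbsoluteValue E ℝ)
    (na : ∀ x y : E, abs (x + y) ≤ max (abs x) (abs y))
    (F : Subfield E) (π : F) (ψ : F → E)
    (C : ℤ → Wq E abs na F → Polynomial E) (φ : F → Polynomial E) : Prop :=
  -- `C_l = 0` for `l` below some `l₀`:
  (∃ l0 : ℤ, ∀ l : ℤ, l < l0 → ∀ β : Wq E abs na F, C l β = 0) ∧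
  -- for every `l`, only finitely many `C_l(β)` are nonzero:
  (∀ l : ℤ, {β : Wq E abs na F | C l β ≠ 0}.Finite) ∧
  -- on each annulus `π^l U_F` the expansion computes `φ`:
  (∀ (l : ℤ) (x : F), abs (x : E) = abs (π : E) ^ l →
    φ x = ∑ᶠ β : Wq E abs na F, ψ (π ^ (-l) * Quotient.out β * x) • C l β)

section Nonarchimedean

variable {E}
variable {abs : AbsoluteValue E ℝ}

theorem abs_sum_le (na : ∀ x y : E, abs (x + y) ≤ max (abs x) (abs y)) {ι : Type*}
    (s : Finset ι) (f : ι → E) {M : ℝ} (hM : 0 ≤ M) (h : ∀ i ∈ s, abs (f i) ≤ M) :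
    abs (∑ i ∈ s, f i) ≤ M := by
  induction s using Finset.induction_on with
  | empty => simpa using hM
  | insert a s ha ih =>
    rw [Finset.sum_insert ha]
    exact (na _ _).trans (max_le (h a (Finset.mem_insert_self a s))
      (ih fun i hi => h i (Finset.mem_insert_of_mem hi)))

theorem abs_sub_le_max (na : ∀ x y : E, abs (x + y) ≤ max (abs x) (abs y)) (x y : E) :
    abs (x - y) ≤ max (abs x) (abs y) := by
  simpa [sub_eq_add_neg] using na x (-y)

theorem abs_natCast_le_one (na : ∀ x y : E, abs (x + y) ≤ max (abs x) (abs y)) (k : ℕ) :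
    abs (k : E) ≤ 1 := by
  induction k with
  | zero => simp
  | succ k ih =>
    push_cast
    exact (na _ _).trans (max_le ih (by simp))

theorem eq_sum_lagrange {n : ℕ} {x : Fin (n + 1) → E} (hx : Function.Injective x)
    {P : Polynomial E} (hP : P.degree ≤ (n : WithBot ℕ)) :
    P = ∑ i, Polynomial.C (P.eval (x i)) * Lagrange.basis Finset.univ x i := by
  have h := Lagrange.eq_interpolate (s := Finset.univ) (v := x) (f := P) hx.injOn
    (by
      rw [Finset.card_fin]
      exact lt_of_le_of_lt hP (by exact_mod_cast Nat.lt_succ_self n))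
  rwa [Lagrange.interpolate_apply] at h

/-- A polynomial of degree at most `n` grows at most like `R ^ n` away from `n + 1` points
at mutual distance `s`. -/
theorem abs_eval_le_of_nodes (na : ∀ x y : E, abs (x + y) ≤ max (abs x) (abs y)) {n : ℕ}
    {x : Fin (n + 1) → E} {s R M : ℝ} (hs : 0 < s) (hM : 0 ≤ M)
    (hx : ∀ i j, i ≠ j → abs (x i - x j) = s)
    {P : Polynomial E} (hP : P.degree ≤ (n : WithBot ℕ)) (hPx : ∀ i, abs (P.eval (x i)) ≤ M)
    {u : E} (hu : ∀ i, abs (u - x i) ≤ R) : abs (P.eval u) ≤ M * (R / s) ^ n := by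
  have hR : 0 ≤ R := (abs.nonneg _).trans (hu 0)
  have hinj : Function.Injective x := by
    intro i j hij
    by_contra hne
    have := hx i j hne
    rw [hij, sub_self, map_zero] at this
    exact hs.ne this
  rw [eq_sum_lagrange hinj hP, Polynomial.eval_finsetSum]
  refine abs_sum_le na _ _ (by positivity) fun i _ => ?_
  rw [Polynomial.eval_mul, Polynomial.eval_C, map_mul]
  refine mul_le_mul (hPx i) ?_ (abs.nonneg _) hM
  rw [Lagrange.basis, Polynomial.eval_prod, map_prod]
  calc ∏ j ∈ Finset.univ.erase i, abs (Polynomial.eval u (Lagrange.basisDivisor (x i) (x j)))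
      ≤ ∏ j ∈ Finset.univ.erase i, (R / s) := by
        refine Finset.prod_le_prod (fun _ _ => abs.nonneg _) fun j hj => ?_
        have hji : i ≠ j := (Finset.ne_of_mem_erase hj).symm
        simp only [Lagrange.basisDivisor, Polynomial.eval_mul, Polynomial.eval_C,
          Polynomial.eval_sub, Polynomial.eval_X, map_mul, map_inv₀, hx i j hji]
        rw [div_eq_inv_mul]
        exact mul_le_mul_of_nonneg_left (hu j) (by positivity)
    _ = (R / s) ^ n := by simp [div_pow]

theorem exists_coeff_bound_of_nodes (na : ∀ x y : E, abs (x + y) ≤ max (abs x) (abs y)) {n : ℕ}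
    {x : Fin (n + 1) → E} (hx : Function.Injective x) {M : ℝ} (hM : 0 ≤ M) :
    ∃ K : ℝ, ∀ P : Polynomial E, P.degree ≤ (n : WithBot ℕ) →
      (∀ i, abs (P.eval (x i)) ≤ M) → ∀ j, abs (P.coeff j) ≤ K := by
  refine ⟨∑ i, ∑ j ∈ Finset.range (n + 1),
    M * abs ((Lagrange.basis Finset.univ x i).coeff j), ?_⟩
  intro P hP hPx j
  have h0 : ∀ i j, 0 ≤ M * abs ((Lagrange.basis Finset.univ x i).coeff j) :=
    fun i j => mul_nonneg hM (abs.nonneg _)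
  have h1 : 0 ≤ ∑ i, ∑ j ∈ Finset.range (n + 1),
      M * abs ((Lagrange.basis Finset.univ x i).coeff j) :=
    Finset.sum_nonneg fun i _ => Finset.sum_nonneg fun j _ => h0 i j
  by_cases hj : j < n + 1
  · rw [eq_sum_lagrange hx hP, Polynomial.finsetSum_coeff]
    refine abs_sum_le na _ _ h1 fun i _ => ?_
    rw [Polynomial.coeff_C_mul, map_mul]
    calc _ ≤ M * abs ((Lagrange.basis Finset.univ x i).coeff j) :=
          mul_le_mul_of_nonneg_right (hPx i) (abs.nonneg _)
      _ ≤ ∑ j ∈ Finset.range (n + 1), M * abs ((Lagrange.basis Finset.univ x i).coeff j) :=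
          Finset.single_le_sum (fun j _ => h0 i j) (Finset.mem_range.2 hj)
      _ ≤ _ := Finset.single_le_sum
          (f := fun i => ∑ j ∈ Finset.range (n + 1),
            M * abs ((Lagrange.basis Finset.univ x i).coeff j))
          (fun i _ => Finset.sum_nonneg fun j _ => h0 i j) (Finset.mem_univ i)
  · rw [Polynomial.coeff_eq_zero_of_degree_lt
      (lt_of_le_of_lt hP (by exact_mod_cast (by omega : n < j))), map_zero]
    exact h1

theorem exists_abs_ge {p : E} (hp0 : p ≠ 0) (hp1 : abs p < 1) (K : ℝ) :
    ∃ κ : E, κ ≠ 0 ∧ K ≤ abs κ := by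
  have h1 : 1 < abs p⁻¹ := by
    rw [map_inv₀]
    exact (one_lt_inv₀ (abs.pos hp0)).2 hp1
  obtain ⟨N, hN⟩ := pow_unbounded_of_one_lt K h1
  exact ⟨p⁻¹ ^ N, pow_ne_zero _ (inv_ne_zero hp0), by rw [map_pow]; exact hN.le⟩

/-- The polynomials of degree at most `n` with coefficients bounded by a nonzero scalar fill
out a lattice. -/
theorem exists_lattice_of_coeff_le (abs : AbsoluteValue E ℝ) (n : ℕ) {κ : E} (hκ : κ ≠ 0) :
    ∃ L : Set (Polynomial E), IsLatticeIn E abs n L ∧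
      ∀ P : Polynomial E, P.degree ≤ (n : WithBot ℕ) → (∀ j, abs (P.coeff j) ≤ abs κ) →
        P ∈ L := by
  have hinj : Function.Injective fun j : ℕ => Polynomial.monomial j κ := by
    intro i j hij
    have h : (Polynomial.monomial i κ).natDegree = (Polynomial.monomial j κ).natDegree :=
      congrArg Polynomial.natDegree hij
    rwa [Polynomial.natDegree_monomial_eq _ hκ, Polynomial.natDegree_monomial_eq _ hκ] at h
  refine ⟨_, ⟨(Finset.range (n + 1)).image fun j => Polynomial.monomial j κ, ?_, rfl⟩, ?_⟩
  · apply le_antisymm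
    · rw [Submodule.span_le]
      intro P hP
      simp only [Finset.coe_image, Set.mem_image, Finset.coe_range, Set.mem_Iio] at hP
      obtain ⟨j, hj, rfl⟩ := hP
      exact Polynomial.mem_degreeLE.2 ((Polynomial.degree_monomial_le _ _).trans
        (by exact_mod_cast Nat.lt_succ_iff.1 hj))
    · rw [Polynomial.degreeLE_eq_span_X_pow, Submodule.span_le]
      intro P hP
      simp only [Finset.coe_image, Set.mem_image, Finset.coe_range, Set.mem_Iio] at hP
      obtain ⟨j, hj, rfl⟩ := hP
      have : (Polynomial.X : Polynomial E) ^ j = κ⁻¹ • Polynomial.monomial j κ := by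
        rw [Polynomial.smul_monomial, smul_eq_mul, inv_mul_cancel₀ hκ,
          Polynomial.monomial_one_right_eq_X_pow]
      rw [this]
      exact Submodule.smul_mem _ _ (Submodule.subset_span
        (Finset.mem_coe.2 (Finset.mem_image_of_mem _ (Finset.mem_range.2 hj))))
  · intro P hP hc
    refine ⟨fun x => P.coeff x.natDegree / κ, fun x => ?_, ?_⟩
    · rw [map_div₀]
      exact div_le_one_of_le₀ (hc _) (abs.nonneg _)
    · rw [Finset.sum_image hinj.injOn]
      conv_lhs => rw [P.as_sum_range' (n + 1)
        (Nat.lt_succ_of_le (Polynomial.natDegree_le_of_degree_le hP))]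
      refine Finset.sum_congr rfl fun j _ => ?_
      beta_reduce
      rw [Polynomial.natDegree_monomial_eq _ hκ, Polynomial.smul_monomial, smul_eq_mul,
        div_mul_cancel₀ _ hκ]

end Nonarchimedean

section Fourier

variable {E}
variable {abs : AbsoluteValue E ℝ} {na : ∀ x y : E, abs (x + y) ≤ max (abs x) (abs y)}
  {F : Subfield E} {π : F}

theorem mkW_eq_mkW_iff {a b : F} :
    mkW E abs na F a = mkW E abs na F b ↔ abs ((a - b : F) : E) ≤ 1 := by
  rw [← sub_eq_zero, ← map_sub]
  exact QuotientAddGroup.eq_zero_iff _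

theorem mkW_out (γ : Wq E abs na F) : mkW E abs na F (Quotient.out γ) = γ :=
  QuotientAddGroup.out_eq' γ

theorem exists_mkW_zpow_mul (hπ0 : π ≠ 0) (k : ℤ) (γ : Wq E abs na F) :
    ∃ u : F, mkW E abs na F (π ^ k * u) = γ :=
  ⟨π ^ (-k) * Quotient.out γ, by
    rw [← mul_assoc, ← zpow_add₀ hπ0, add_neg_cancel, zpow_zero, one_mul, mkW_out]⟩

theorem pmulW_mkW (hπ : abs (π : E) ≤ 1) (b : F) :
    pmulW E abs na F π hπ (mkW E abs na F b) = mkW E abs na F (π * b) := rfl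

theorem abs_coe_zpow (k : ℤ) : abs ((π ^ k : F) : E) = abs (π : E) ^ k := by
  exact map_zpow₀ abs _ _

theorem psi_mul_psi_neg {ψ : F → E} (hψadd : ∀ x y : F, ψ (x + y) = ψ x * ψ y)
    (hψO : ∀ x : F, abs (x : E) ≤ 1 → ψ x = 1) (x : F) : ψ x * ψ (-x) = 1 := by
  rw [← hψadd, add_neg_cancel]
  exact hψO 0 (by simp)

theorem psi_congr {ψ : F → E} (hψadd : ∀ x y : F, ψ (x + y) = ψ x * ψ y)
    (hψO : ∀ x : F, abs (x : E) ≤ 1 → ψ x = 1) {a b x : F}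
    (hab : mkW E abs na F a = mkW E abs na F b) (hx : abs (x : E) ≤ 1) :
    ψ (a * x) = ψ (b * x) := by
  have h : a * x = b * x + (a - b) * x := by ring
  rw [h, hψadd, hψO ((a - b) * x), mul_one]
  rw [mkW_eq_mkW_iff] at hab
  rw [Subfield.coe_mul, map_mul]
  exact mul_le_one₀ hab (abs.nonneg _) hx

theorem psi_out {ψ : F → E} (hψadd : ∀ x y : F, ψ (x + y) = ψ x * ψ y)
    (hψO : ∀ x : F, abs (x : E) ≤ 1 → ψ x = 1) (b : F) {x : F} (hx : abs (x : E) ≤ 1) :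
    ψ (Quotient.out (mkW E abs na F b) * x) = ψ (b * x) :=
  psi_congr hψadd hψO (mkW_out (mkW E abs na F b)) hx

variable (abs na) in
/-- The function `∑ γ, f γ ψ_γ` on `O_F` with Fourier coefficients `f`. -/
def hat (ψ : F → E) (x : F) : (Wq E abs na F →₀ Polynomial E) →ₗ[E] Polynomial E :=
  Finsupp.lsum E fun γ => ψ (Quotient.out γ * x) • LinearMap.id

theorem hat_apply (ψ : F → E) (x : F) (f : Wq E abs na F →₀ Polynomial E) :
    hat abs na ψ x f = f.sum fun γ P => ψ (Quotient.out γ * x) • P := by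
  rw [hat, Finsupp.lsum_apply]
  rfl

theorem hat_single {ψ : F → E} (hψadd : ∀ x y : F, ψ (x + y) = ψ x * ψ y)
    (hψO : ∀ x : F, abs (x : E) ≤ 1 → ψ x = 1) (b : F) (P : Polynomial E) {x : F}
    (hx : abs (x : E) ≤ 1) :
    hat abs na ψ x (Finsupp.single (mkW E abs na F b) P) = ψ (b * x) • P := by
  rw [hat_apply, Finsupp.sum_single_index (by simp), psi_out hψadd hψO b hx]

/-- Translation of Fourier coefficients. -/
def shift (η : Wq E abs na F) :
    (Wq E abs na F →₀ Polynomial E) →ₗ[E] (Wq E abs na F →₀ Polynomial E) :=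
  Finsupp.lmapDomain (Polynomial E) E fun γ => γ + η

theorem shift_apply (η γ : Wq E abs na F) (f : Wq E abs na F →₀ Polynomial E) :
    shift η f γ = f (γ - η) := by
  have h := Finsupp.mapDomain_apply (add_left_injective η) f (γ - η)
  rwa [sub_add_cancel] at h

theorem hat_shift {ψ : F → E} (hψadd : ∀ x y : F, ψ (x + y) = ψ x * ψ y)
    (hψO : ∀ x : F, abs (x : E) ≤ 1 → ψ x = 1) (b : F)
    (f : Wq E abs na F →₀ Polynomial E) {x : F} (hx : abs (x : E) ≤ 1) :
    hat abs na ψ x (shift (mkW E abs na F b) f) = ψ (b * x) • hat abs na ψ x f := by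
  induction f using Finsupp.induction_linear with
  | zero => simp
  | add f g hf hg => rw [map_add, map_add, hf, hg, map_add, smul_add]
  | single γ P =>
    rw [← mkW_out γ, shift, Finsupp.lmapDomain_apply, Finsupp.mapDomain_single, ← map_add,
      hat_single hψadd hψO _ _ hx, hat_single hψadd hψO _ _ hx, smul_smul, ← hψadd]
    congr 2
    ring

/-- Linear independence of the characters `ψ_γ` of `O_F`. -/
theorem eq_zero_of_hat_eq_zero {ψ : F → E} (hψadd : ∀ x y : F, ψ (x + y) = ψ x * ψ y)
    (hψO : ∀ x : F, abs (x : E) ≤ 1 → ψ x = 1)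
    (hψann : ∀ b : F, 1 < abs (b : E) → ∃ x : F, abs (x : E) ≤ 1 ∧ ψ (b * x) ≠ 1)
    {f : Wq E abs na F →₀ Polynomial E}
    (hf : ∀ x : F, abs (x : E) ≤ 1 → hat abs na ψ x f = 0) : f = 0 := by
  let ch : Wq E abs na F → (Multiplicative (OFadd E abs na F) →* E) := fun γ =>
    { toFun := fun x => ψ (Quotient.out γ * (x.toAdd : F))
      map_one' := hψO _ (by simp)
      map_mul' := fun x y => by
        rw [← hψadd, toAdd_mul, AddSubgroup.coe_add, mul_add] }
  have hch : Function.Injective ch := by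
    intro γ δ h
    rw [← mkW_out γ, ← mkW_out δ, mkW_eq_mkW_iff]
    by_contra! hlt
    obtain ⟨x, hx, hne⟩ := hψann _ hlt
    apply hne
    have h2 : ψ (Quotient.out γ * x) = ψ (Quotient.out δ * x) :=
      DFunLike.congr_fun h (Multiplicative.ofAdd (⟨x, hx⟩ : OFadd E abs na F))
    rw [sub_mul, sub_eq_add_neg, hψadd, h2, psi_mul_psi_neg hψadd hψO]
  have hli := (linearIndependent_monoidHom (Multiplicative (OFadd E abs na F)) E).comp ch hch
  rw [linearIndependent_iff] at hli
  ext γ j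
  have h0 := hli (f.mapRange (fun P => P.coeff j) (Polynomial.coeff_zero j)) (by
    funext x
    have h1 := congrArg (fun P => Polynomial.coeff P j) (hf (x.toAdd : F) x.toAdd.2)
    simp only [hat_apply, Finsupp.sum, Polynomial.finsetSum_coeff, Polynomial.coeff_smul,
      Polynomial.coeff_zero] at h1
    have h2 : Finsupp.linearCombination E
        ((fun f : Multiplicative (OFadd E abs na F) →* E => (f : _ → E)) ∘ ch)
        (f.mapRange (fun P => P.coeff j) (Polynomial.coeff_zero j)) =
        f.sum fun γ P => P.coeff j • (ch γ : _ → E) := by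
      rw [Finsupp.linearCombination_apply]
      exact Finsupp.sum_mapRange_index fun _ => zero_smul _ _
    rw [h2, Finsupp.sum, Finset.sum_apply, Pi.zero_apply, ← h1]
    refine Finset.sum_congr rfl fun γ _ => ?_
    simp only [Pi.smul_apply, smul_eq_mul]
    exact mul_comm _ _)
  exact DFunLike.congr_fun h0 γ

theorem apply_eq_of_hat_eq_zero_on_units (hπ0 : π ≠ 0) (hπ1 : abs (π : E) < 1)
    (hsmall : ∀ x : F, abs (x : E) < 1 → abs (x : E) ≤ abs (π : E))
    {ψ : F → E} (hψadd : ∀ x y : F, ψ (x + y) = ψ x * ψ y)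
    (hψO : ∀ x : F, abs (x : E) ≤ 1 → ψ x = 1)
    (hψann : ∀ b : F, 1 < abs (b : E) → ∃ x : F, abs (x : E) ≤ 1 ∧ ψ (b * x) ≠ 1)
    {f : Wq E abs na F →₀ Polynomial E}
    (hf : ∀ x : F, abs (x : E) = 1 → hat abs na ψ x f = 0) {γ δ : Wq E abs na F}
    (hγδ : pmulW E abs na F π hπ1.le γ = pmulW E abs na F π hπ1.le δ) : f γ = f δ := by
  have key : shift (δ - γ) f - f = 0 := by
    apply eq_zero_of_hat_eq_zero hψadd hψO hψann
    intro x hx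
    rw [map_sub]
    nth_rewrite 1 [← mkW_out (δ - γ)]
    rw [hat_shift hψadd hψO _ _ hx]
    rcases hx.lt_or_eq with h | h
    · have hy : abs ((π⁻¹ * x : F) : E) ≤ 1 := by
        push_cast
        rw [map_mul, map_inv₀]
        have hp : 0 < abs (π : E) := abs.pos (by simpa using hπ0)
        rw [inv_mul_le_iff₀ hp, mul_one]
        exact hsmall x h
      have h1 : mkW E abs na F (π * Quotient.out (δ - γ)) = mkW E abs na F 0 := by
        rw [← pmulW_mkW hπ1.le, mkW_out, map_sub, hγδ, sub_self, map_zero]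
      have h2 : Quotient.out (δ - γ) * x = π * Quotient.out (δ - γ) * (π⁻¹ * x) := by
        field_simp
      rw [h2, psi_congr hψadd hψO h1 hy, zero_mul, hψO 0 (by simp), one_smul, sub_self]
    · rw [hf x h, smul_zero, sub_self]
  have h := DFunLike.congr_fun key δ
  rw [Finsupp.sub_apply, shift_apply, Finsupp.zero_apply, sub_sub_cancel, sub_eq_zero] at h
  exact h

/-- Summation over the fibres of multiplication by `π`, corresponding to `g(x) ↦ g(πx)`. -/
def push (hπ1 : abs (π : E) < 1) :
    (Wq E abs na F →₀ Polynomial E) →ₗ[E] (Wq E abs na F →₀ Polynomial E) :=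
  Finsupp.lmapDomain (Polynomial E) E (pmulW E abs na F π hπ1.le)

theorem push_single (hπ1 : abs (π : E) < 1) (b : F) (P : Polynomial E) :
    push (na := na) hπ1 (Finsupp.single (mkW E abs na F b) P)
      = Finsupp.single (mkW E abs na F (π * b)) P := by
  rw [push, Finsupp.lmapDomain_apply, Finsupp.mapDomain_single, pmulW_mkW]

theorem push_shift (hπ1 : abs (π : E) < 1) {η : Wq E abs na F}
    (hη : pmulW E abs na F π hπ1.le η = 0) (f : Wq E abs na F →₀ Polynomial E) :
    push hπ1 (shift η f) = push hπ1 f := by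
  rw [push, shift, Finsupp.lmapDomain_apply, Finsupp.lmapDomain_apply,
    Finsupp.lmapDomain_apply, ← Finsupp.mapDomain_comp]
  congr 1
  funext γ
  simp [hη]

theorem push_apply (hπ1 : abs (π : E) < 1)
    (hfin : ∀ γ : Wq E abs na F, Finite {β // pmulW E abs na F π hπ1.le β = γ})
    (f : Wq E abs na F →₀ Polynomial E) (γ : Wq E abs na F) :
    push hπ1 f γ = ∑ᶠ β : {β // pmulW E abs na F π hπ1.le β = γ}, f β := by
  have := hfin γ
  have := Fintype.ofFinite {β // pmulW E abs na F π hπ1.le β = γ}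
  rw [finsum_eq_sum_of_fintype, push, Finsupp.lmapDomain_apply]
  induction f using Finsupp.induction_linear with
  | zero => simp
  | add f g hf hg =>
    rw [Finsupp.mapDomain_add, Finsupp.add_apply, hf, hg, ← Finset.sum_add_distrib]
    rfl
  | single δ P =>
    rw [Finsupp.mapDomain_single]
    by_cases h : pmulW E abs na F π hπ1.le δ = γ
    · rw [h, Finsupp.single_eq_same, Finset.sum_eq_single ⟨δ, h⟩]
      · simp
      · intro β _ hβ
        exact Finsupp.single_eq_of_ne fun h' => hβ (Subtype.ext h')
      · simp
    · rw [Finsupp.single_eq_of_ne (Ne.symm h), Finset.sum_eq_zero]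
      rintro ⟨β, hβ⟩ _
      exact Finsupp.single_eq_of_ne fun h' => h (h' ▸ hβ)

theorem push_apply_of_const (hπ1 : abs (π : E) < 1) {q : ℕ} (hq : 0 < q)
    (hcard : ∀ γ : Wq E abs na F,
      Nat.card {β : Wq E abs na F // pmulW E abs na F π hπ1.le β = γ} = q)
    {f : Wq E abs na F →₀ Polynomial E}
    (hf : ∀ γ δ, pmulW E abs na F π hπ1.le γ = pmulW E abs na F π hπ1.le δ → f γ = f δ)
    (δ : Wq E abs na F) :
    push hπ1 f (pmulW E abs na F π hπ1.le δ) = (q : E) • f δ := by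
  have hfin : ∀ γ : Wq E abs na F, Finite {β // pmulW E abs na F π hπ1.le β = γ} :=
    fun γ => Nat.finite_of_card_ne_zero (by rw [hcard]; omega)
  rw [push_apply hπ1 hfin]
  have := hfin (pmulW E abs na F π hπ1.le δ)
  have := Fintype.ofFinite {β // pmulW E abs na F π hπ1.le β = pmulW E abs na F π hπ1.le δ}
  rw [finsum_eq_sum_of_fintype, Finset.sum_congr rfl fun β _ => hf β.1 δ β.2, Finset.sum_const,
    Finset.card_univ, ← Nat.card_eq_fintype_card, hcard, ← Nat.cast_smul_eq_nsmul E]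

theorem degree_push_le (hπ1 : abs (π : E) < 1) {n : ℕ} {f : Wq E abs na F →₀ Polynomial E}
    (hf : ∀ γ, (f γ).degree ≤ (n : WithBot ℕ)) (γ : Wq E abs na F) :
    (push hπ1 f γ).degree ≤ (n : WithBot ℕ) := by
  rw [push, Finsupp.lmapDomain_apply, Finsupp.mapDomain, Finsupp.sum, Finsupp.finsetSum_apply,
    ← Polynomial.mem_degreeLE]
  refine Submodule.sum_mem _ fun δ _ => ?_
  rw [Finsupp.single_apply]
  split_ifs
  · exact Polynomial.mem_degreeLE.2 (hf δ)
  · exact Submodule.zero_mem _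

theorem abs_eval_push_le (hπ1 : abs (π : E) < 1) (f : Wq E abs na F →₀ Polynomial E)
    (γ : Wq E abs na F) (v : E) {M : ℝ} (hM : 0 ≤ M)
    (h : ∀ δ, pmulW E abs na F π hπ1.le δ = γ → abs ((f δ).eval v) ≤ M) :
    abs ((push hπ1 f γ).eval v) ≤ M := by
  rw [push, Finsupp.lmapDomain_apply, Finsupp.mapDomain, Finsupp.sum, Finsupp.finsetSum_apply,
    Polynomial.eval_finsetSum]
  refine abs_sum_le na _ _ hM fun δ _ => ?_
  rw [Finsupp.single_apply]
  split_ifs with hδ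
  · exact h δ hδ
  · simpa using hM

end Fourier

section ResidueField

variable {E}
variable {abs : AbsoluteValue E ℝ} {na : ∀ x y : E, abs (x + y) ≤ max (abs x) (abs y)}
  {F : Subfield E} {π : F}

variable (abs F) in
/-- `res`, restricted to `O_F`, is the reduction map onto the residue field `k`. -/
structure IsResidueMap {k : Type} [Field k] (res : F → k) : Prop where
  map_add : ∀ x y : F, abs (x : E) ≤ 1 → abs (y : E) ≤ 1 → res (x + y) = res x + res y
  map_mul : ∀ x y : F, abs (x : E) ≤ 1 → abs (y : E) ≤ 1 → res (x * y) = res x * res y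
  map_one : res 1 = 1
  eq_zero_iff : ∀ x : F, abs (x : E) ≤ 1 → (res x = 0 ↔ abs (x : E) < 1)
  surj : ∀ y : k, ∃ x : F, abs (x : E) ≤ 1 ∧ res x = y

theorem IsResidueMap.map_sub {k : Type} [Field k] {res : F → k} (hres : IsResidueMap abs F res)
    (na : ∀ x y : E, abs (x + y) ≤ max (abs x) (abs y))
    {x y : F} (hx : abs (x : E) ≤ 1) (hy : abs (y : E) ≤ 1) :
    res (x - y) = res x - res y := by
  have h : abs ((x - y : F) : E) ≤ 1 := (abs_sub_le_max na _ _).trans (max_le hx hy)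
  rw [eq_sub_iff_add_eq, ← hres.map_add _ _ h hy, sub_add_cancel]

theorem IsResidueMap.eq_iff {k : Type} [Field k] {res : F → k} (hres : IsResidueMap abs F res)
    (na : ∀ x y : E, abs (x + y) ≤ max (abs x) (abs y))
    {x y : F} (hx : abs (x : E) ≤ 1) (hy : abs (y : E) ≤ 1) :
    res x = res y ↔ abs ((x - y : F) : E) < 1 := by
  have h : abs ((x - y : F) : E) ≤ 1 := (abs_sub_le_max na _ _).trans (max_le hx hy)
  rw [← hres.eq_zero_iff _ h, hres.map_sub na hx hy, sub_eq_zero]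

theorem IsResidueMap.ne_zero_iff {k : Type} [Field k] {res : F → k}
    (hres : IsResidueMap abs F res) {x : F} (hx : abs (x : E) ≤ 1) :
    res x ≠ 0 ↔ abs (x : E) = 1 := by
  rw [Ne, hres.eq_zero_iff x hx, not_lt]
  exact ⟨fun h => le_antisymm hx h, fun h => h.ge⟩

theorem exists_isResidueMap (na : ∀ x y : E, abs (x + y) ≤ max (abs x) (abs y))
    (F : Subfield E) :
    ∃ (k : Type) (_ : Field k) (res : F → k), IsResidueMap abs F res := by
  let v : Valuation F NNReal :=
    { toFun := fun x => Real.toNNReal (abs (x : E))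
      map_zero' := by simp
      map_one' := by simp
      map_mul' := fun x y => by simp [Real.toNNReal_mul (abs.nonneg (x : E))]
      map_add_le_max' := fun x y =>
        (Real.toNNReal_le_toNNReal (na (x : E) (y : E))).trans_eq
          (Monotone.map_max fun _ _ h => Real.toNNReal_le_toNNReal h) }
  have hv : ∀ x : F, abs (x : E) ≤ 1 → x ∈ v.valuationSubring := fun x hx =>
    Real.toNNReal_le_one.2 hx
  refine ⟨IsLocalRing.ResidueField v.valuationSubring, inferInstance,
    fun x => if h : abs (x : E) ≤ 1 then IsLocalRing.residue v.valuationSubring ⟨x, hv x h⟩ else 0,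
    ?_, ?_, ?_, ?_, ?_⟩
  · intro x y hx hy
    have hxy : abs ((x + y : F) : E) ≤ 1 := (na _ _).trans (max_le hx hy)
    rw [dif_pos hx, dif_pos hy, dif_pos hxy, ← _root_.map_add]
    rfl
  · intro x y hx hy
    have hxy : abs ((x * y : F) : E) ≤ 1 := by
      rw [Subfield.coe_mul, abs.map_mul]
      exact mul_le_one₀ hx (abs.nonneg _) hy
    rw [dif_pos hx, dif_pos hy, dif_pos hxy, ← _root_.map_mul]
    rfl
  · rw [dif_pos (by simp)]
    exact _root_.map_one _
  · intro x hx
    rw [dif_pos hx, IsLocalRing.residue_eq_zero_iff, Valuation.mem_maximalIdeal_iff]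
    exact Real.toNNReal_lt_one
  · intro y
    obtain ⟨x, rfl⟩ := IsLocalRing.residue_surjective y
    have hx : abs ((x : F) : E) ≤ 1 := Real.toNNReal_le_one.1 x.2
    exact ⟨x, hx, by rw [dif_pos hx]⟩

theorem abs_le_of_abs_lt_one (hπ0 : π ≠ 0) (hπ1 : abs (π : E) < 1)
    (hdisc : ∀ x : F, x ≠ 0 → ∃ k : ℤ, abs (x : E) = abs (π : E) ^ k) (x : F)
    (hx : abs (x : E) < 1) : abs (x : E) ≤ abs (π : E) := by
  have hp : 0 < abs (π : E) := abs.pos (by simpa using hπ0)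
  by_cases h : x = 0
  · simp [h]
  · obtain ⟨k, hk⟩ := hdisc x h
    rw [hk] at hx ⊢
    have h1 : 0 < k := by
      by_contra! hk0
      exact absurd hx (not_lt.2 (one_le_zpow_of_nonpos₀ hp hπ1.le hk0))
    calc abs (π : E) ^ k ≤ abs (π : E) ^ (1 : ℤ) :=
          zpow_le_zpow_right_of_le_one₀ hp hπ1.le (by omega)
      _ = _ := zpow_one _

theorem card_residue (hπ0 : π ≠ 0) (hπ1 : abs (π : E) < 1)
    (hsmall : ∀ x : F, abs (x : E) < 1 → abs (x : E) ≤ abs (π : E))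
    {k : Type} [Field k] {res : F → k} (hres : IsResidueMap abs F res) :
    Nat.card k = Nat.card {β : Wq E abs na F // pmulW E abs na F π hπ1.le β = 0} := by
  have hp : 0 < abs (π : E) := abs.pos (by simpa using hπ0)
  choose lift hlift1 hlift using hres.surj
  refine Nat.card_eq_of_bijective
    (fun y => ⟨mkW E abs na F (π⁻¹ * lift y), ?_⟩) ⟨?_, ?_⟩
  · rw [pmulW_mkW, mul_inv_cancel_left₀ hπ0]
    exact (mkW_eq_mkW_iff (b := 0)).2 (by simpa using hlift1 y)
  · intro y z hyz
    have h := mkW_eq_mkW_iff.1 (Subtype.ext_iff.1 hyz)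
    rw [← mul_sub, Subfield.coe_mul, abs.map_mul, Subfield.coe_inv, map_inv₀,
      inv_mul_le_iff₀ hp, mul_one] at h
    rw [← hlift y, ← hlift z, hres.eq_iff na (hlift1 y) (hlift1 z)]
    exact h.trans_lt hπ1
  · rintro ⟨β, hβ⟩
    have hb : abs ((π * Quotient.out β : F) : E) ≤ 1 := by
      rw [← mkW_out β, pmulW_mkW, ← map_zero (mkW E abs na F), mkW_eq_mkW_iff, sub_zero] at hβ
      exact hβ
    refine ⟨res (π * Quotient.out β), Subtype.ext ?_⟩
    refine (mkW_eq_mkW_iff.2 ?_).trans (mkW_out β)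
    have h := (hres.eq_iff na (hlift1 _) hb).1 (hlift (res (π * Quotient.out β)))
    have h2 : π⁻¹ * lift (res (π * Quotient.out β)) - Quotient.out β
        = π⁻¹ * (lift (res (π * Quotient.out β)) - π * Quotient.out β) := by
      field_simp
    rw [h2, Subfield.coe_mul, abs.map_mul, Subfield.coe_inv, map_inv₀,
      inv_mul_le_iff₀ hp, mul_one]
    exact hsmall _ h

theorem exists_nodes (na : ∀ x y : E, abs (x + y) ≤ max (abs x) (abs y))
    {k : Type} [Field k] {res : F → k} (hres : IsResidueMap abs F res)
    {n : ℕ} (hn : n < Nat.card k) :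
    ∃ t : Fin (n + 1) → F, (∀ i, abs (t i : E) ≤ 1) ∧
      ∀ i j, i ≠ j → abs ((t i - t j : F) : E) = 1 := by
  have : Finite k := Nat.finite_of_card_ne_zero (by omega)
  choose lift hlift1 hlift using hres.surj
  let e : Fin (n + 1) → k := fun i => (Finite.equivFin k).symm (Fin.castLE hn i)
  have he : Function.Injective e := fun i j h =>
    Fin.castLE_injective hn ((Finite.equivFin k).symm.injective h)
  refine ⟨fun i => lift (e i), fun i => hlift1 _, fun i j hij => ?_⟩
  have h : abs ((lift (e i) - lift (e j) : F) : E) ≤ 1 :=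
    (abs_sub_le_max na _ _).trans (max_le (hlift1 _) (hlift1 _))
  refine le_antisymm h (not_lt.1 fun hlt => hij (he ?_))
  rwa [← hres.eq_iff na (hlift1 _) (hlift1 _), hlift, hlift] at hlt

theorem exists_addChar (na : ∀ x y : E, abs (x + y) ≤ max (abs x) (abs y))
    (hπ0 : π ≠ 0) (hπ1 : abs (π : E) < 1)
    (hsmall : ∀ x : F, abs (x : E) < 1 → abs (x : E) ≤ abs (π : E))
    {ψ : F → E} (hψadd : ∀ x y : F, ψ (x + y) = ψ x * ψ y)
    (hψO : ∀ x : F, abs (x : E) ≤ 1 → ψ x = 1)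
    (hψann : ∀ b : F, 1 < abs (b : E) → ∃ x : F, abs (x : E) ≤ 1 ∧ ψ (b * x) ≠ 1)
    {k : Type} [Field k] {res : F → k} (hres : IsResidueMap abs F res) :
    ∃ e : AddChar k E, e.IsPrimitive ∧
      ∀ x : F, abs (x : E) ≤ 1 → e (res x) = ψ (π⁻¹ * x) := by
  have hp : 0 < abs (π : E) := abs.pos (by simpa using hπ0)
  choose lift hlift1 hlift using hres.surj
  have key : ∀ x y : F, abs (x : E) ≤ 1 → abs (y : E) ≤ 1 → res x = res y →
      ψ (π⁻¹ * x) = ψ (π⁻¹ * y) := by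
    intro x y hx hy hxy
    rw [hres.eq_iff na hx hy] at hxy
    have h : π⁻¹ * x = π⁻¹ * y + π⁻¹ * (x - y) := by ring
    rw [h, hψadd, hψO (π⁻¹ * (x - y)), mul_one]
    rw [Subfield.coe_mul, abs.map_mul, Subfield.coe_inv, map_inv₀, inv_mul_le_iff₀ hp, mul_one]
    exact hsmall _ hxy
  let e : AddChar k E :=
    { toFun := fun y => ψ (π⁻¹ * lift y)
      map_zero_eq_one' := by
        rw [key (lift 0) 0 (hlift1 0) (by simp)]
        · rw [mul_zero]
          exact hψO 0 (by simp)
        · rw [hlift, (hres.eq_zero_iff 0 (by simp)).2 (by simp)]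
      map_add_eq_mul' := fun y z => by
        rw [← hψadd, ← mul_add]
        have h : abs ((lift y + lift z : F) : E) ≤ 1 :=
          (na _ _).trans (max_le (hlift1 y) (hlift1 z))
        exact key _ _ (hlift1 _) h (by rw [hlift, hres.map_add _ _ (hlift1 y) (hlift1 z),
          hlift, hlift]) }
  have he : ∀ x : F, abs (x : E) ≤ 1 → e (res x) = ψ (π⁻¹ * x) :=
    fun x hx => key _ _ (hlift1 _) hx (hlift _)
  refine ⟨e, AddChar.IsPrimitive.of_ne_one ?_, he⟩
  intro h1
  obtain ⟨x, hx, hne⟩ := hψann π⁻¹ (by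
    rw [Subfield.coe_inv, map_inv₀]
    exact (one_lt_inv₀ hp).2 hπ1)
  apply hne
  rw [← he x hx, h1, AddChar.one_apply]

/-- The multiplicative character of the residue field attached to a tamely ramified
character. -/
theorem exists_mulChar (na : ∀ x y : E, abs (x + y) ≤ max (abs x) (abs y))
    (hsmall : ∀ x : F, abs (x : E) < 1 → abs (x : E) ≤ abs (π : E))
    {χ : Fˣ →* Eˣ}
    (hχ : ∀ u : Fˣ, abs (((u : F) : E) - 1) ≤ abs (π : E) → χ u = 1)
    {k : Type} [Field k] {res : F → k} (hres : IsResidueMap abs F res) :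
    ∃ θ : MulChar k E, ∀ u : Fˣ, abs ((u : F) : E) = 1 → θ (res u) = χ u := by
  choose lift hlift1 hlift using hres.surj
  have hlift0 : ∀ y : k, y ≠ 0 → abs (lift y : E) = 1 := fun y hy => by
    rwa [← hres.ne_zero_iff (hlift1 y), hlift]
  have hne : ∀ y : k, y ≠ 0 → lift y ≠ 0 := fun y hy h => by
    have := hlift0 y hy
    simp [h] at this
  have key : ∀ u v : Fˣ, abs ((u : F) : E) = 1 → abs ((v : F) : E) = 1 →
      res u = res v → χ u = χ v := by
    intro u v hu hv huv
    rw [hres.eq_iff na hu.le hv.le] at huv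
    rw [← div_eq_one, ← map_div]
    apply hχ
    have h : ((((u / v : Fˣ) : F) : E) - 1) = (((v : F) : E))⁻¹ * (((u : F) - (v : F) : F) : E) := by
      have : ((v : F) : E) ≠ 0 := by simp
      rw [Units.val_div_eq_div_val]
      push_cast
      field_simp
    rw [h, abs.map_mul, map_inv₀, hv, inv_one, one_mul]
    exact hsmall _ huv
  let t : k → E := fun y => if h : y = 0 then 0 else χ (Units.mk0 (lift y) (hne y h))
  refine ⟨{ toFun := t, map_one' := ?_, map_mul' := ?_, map_nonunit' := ?_ }, ?_⟩
  · have h1 : (1 : k) ≠ 0 := one_ne_zero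
    simp only [t, dif_neg h1]
    rw [key _ 1 (hlift0 1 h1) (by simp) (by rw [Units.val_mk0, hlift, Units.val_one, hres.map_one])]
    simp
  · intro y z
    by_cases hy : y = 0
    · simp [t, hy]
    by_cases hz : z = 0
    · simp [t, hz]
    have hyz : y * z ≠ 0 := mul_ne_zero hy hz
    simp only [t, dif_neg hy, dif_neg hz, dif_neg hyz]
    rw [← Units.val_mul, ← map_mul]
    congr 1
    apply key
    · exact hlift0 _ hyz
    · simp [hlift0 _ hy, hlift0 _ hz]
    · rw [Units.val_mul, Units.val_mk0, Units.val_mk0, Units.val_mk0,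
        hres.map_mul _ _ (hlift1 _) (hlift1 _), hlift, hlift, hlift]
  · intro y hy
    rw [isUnit_iff_ne_zero, not_not] at hy
    simp [t, hy]
  · intro u hu
    have h := (hres.ne_zero_iff hu.le).2 hu
    change t (res u) = _
    simp only [t, dif_neg h]
    rw [key _ u (hlift0 _ h) hu (hlift _)]

theorem abs_mulChar_eq_one {k : Type} [Field k] [Fintype k] (θ : MulChar k E) {y : k}
    (hy : y ≠ 0) : abs (θ y) = 1 := by
  have h1 : θ y ^ (Fintype.card k - 1) = 1 := by
    rw [← map_pow, FiniteField.pow_card_sub_one_eq_one y hy, map_one]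
  have h2 : abs (θ y) ^ (Fintype.card k - 1) = 1 := by rw [← map_pow, h1, map_one]
  have := Fintype.one_lt_card (α := k)
  exact (pow_eq_one_iff_of_nonneg (abs.nonneg _) (by omega)).1 h2

/-- Coefficients of a function on the residue field in the characters `x ↦ e (y * x)`. -/
def fourierCoeff {k : Type} [Field k] [Fintype k] (e : AddChar k E) (t : k → E) (y : k) : E :=
  (Fintype.card k : E)⁻¹ * ∑ z, t z * e (-(y * z))

theorem sum_fourierCoeff_mul [CharZero E] {k : Type} [Field k] [Fintype k] {e : AddChar k E}
    (he : e.IsPrimitive) (t : k → E) (x : k) :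
    ∑ y, fourierCoeff e t y * e (y * x) = t x := by
  have hc : (Fintype.card k : E) ≠ 0 := by
    exact_mod_cast Fintype.card_ne_zero
  calc ∑ y, fourierCoeff e t y * e (y * x)
      = (Fintype.card k : E)⁻¹ * ∑ z, t z * ∑ y, e (y * (x - z)) := by
        simp only [fourierCoeff, Finset.mul_sum, Finset.sum_mul]
        rw [Finset.sum_comm]
        refine Finset.sum_congr rfl fun z _ => Finset.sum_congr rfl fun y _ => ?_
        rw [show y * (x - z) = -(y * z) + y * x by ring, AddChar.map_add_eq_mul]
        ring
    _ = t x := by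
        simp only [AddChar.sum_mulShift _ he, sub_eq_zero]
        rw [Finset.sum_eq_single x]
        · simp only [if_true]
          field_simp
        · intro z _ hz
          simp [Ne.symm hz]
        · simp

theorem abs_fourierCoeff_mulChar_le {k : Type} [Field k] [Fintype k] (e : AddChar k E)
    {θ : MulChar k E} (hθ : θ ≠ 1) (y : k) :
    abs (fourierCoeff e θ y) ≤ (abs (Fintype.card k : E))⁻¹ * abs (gaussSum θ e) := by
  rw [fourierCoeff, abs.map_mul, map_inv₀]
  refine mul_le_mul_of_nonneg_left ?_ (by positivity)
  by_cases hy : y = 0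
  · simp [hy, θ.sum_eq_zero_of_ne_one hθ]
  · have h := gaussSum_mulShift θ e (Units.mk0 (-y) (neg_ne_zero.2 hy))
    have h2 := congrArg abs h
    rw [abs.map_mul, Units.val_mk0, abs_mulChar_eq_one θ (neg_ne_zero.2 hy), one_mul] at h2
    rw [← h2, gaussSum]
    simp [AddChar.mulShift_apply]

theorem abs_gaussSum_mul_abs_gaussSum_inv {k : Type} [Field k] [Fintype k] {e : AddChar k E}
    (he : e.IsPrimitive) {θ : MulChar k E} (hθ : θ ≠ 1) :
    abs (gaussSum θ e) * abs (gaussSum θ⁻¹ e) = abs (Fintype.card k : E) := by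
  rw [← gaussSum_mul_gaussSum_eq_card hθ he, ← mul_gaussSum_inv_eq_gaussSum θ⁻¹ e,
    abs.map_mul, abs.map_mul, abs_mulChar_eq_one _ (neg_ne_zero.2 one_ne_zero), one_mul]

/-- Multiplication by a function of the residue class, on the side of Fourier
coefficients. -/
def residueMul {k : Type} [Field k] [Fintype k] (e : AddChar k E) (δ : k → Wq E abs na F)
    (t : k → E) : (Wq E abs na F →₀ Polynomial E) →ₗ[E] (Wq E abs na F →₀ Polynomial E) :=
  ∑ y, fourierCoeff e t y • shift (δ y)

theorem residueMul_apply {k : Type} [Field k] [Fintype k] (e : AddChar k E)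
    (δ : k → Wq E abs na F) (t : k → E) (f : Wq E abs na F →₀ Polynomial E)
    (γ : Wq E abs na F) :
    residueMul e δ t f γ = ∑ y, fourierCoeff e t y • f (γ - δ y) := by
  simp [residueMul, LinearMap.sum_apply, Finsupp.finsetSum_apply, shift_apply]

theorem hat_residueMul [CharZero E] {ψ : F → E} (hψadd : ∀ x y : F, ψ (x + y) = ψ x * ψ y)
    (hψO : ∀ x : F, abs (x : E) ≤ 1 → ψ x = 1)
    {k : Type} [Field k] [Fintype k] {res : F → k} (hres : IsResidueMap abs F res)
    {e : AddChar k E} (he : e.IsPrimitive)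
    (heψ : ∀ x : F, abs (x : E) ≤ 1 → e (res x) = ψ (π⁻¹ * x))
    {lift : k → F} (hlift1 : ∀ y, abs (lift y : E) ≤ 1) (hlift : ∀ y, res (lift y) = y)
    (t : k → E) (f : Wq E abs na F →₀ Polynomial E) {x : F} (hx : abs (x : E) ≤ 1) :
    hat abs na ψ x (residueMul e (fun y => mkW E abs na F (π⁻¹ * lift y)) t f)
      = t (res x) • hat abs na ψ x f := by
  rw [← sum_fourierCoeff_mul he t (res x), Finset.sum_smul, residueMul, LinearMap.sum_apply,
    map_sum]
  refine Finset.sum_congr rfl fun y _ => ?_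
  have hxy : abs ((lift y * x : F) : E) ≤ 1 := by
    rw [Subfield.coe_mul, abs.map_mul]
    exact mul_le_one₀ (hlift1 y) (abs.nonneg _) hx
  have h : e (y * res x) = ψ (π⁻¹ * lift y * x) := by
    rw [mul_assoc, ← heψ _ hxy, hres.map_mul _ _ (hlift1 y) hx, hlift]
  rw [LinearMap.smul_apply, map_smul, hat_shift hψadd hψO _ _ hx, smul_smul, h]

theorem degree_residueMul_le {k : Type} [Field k] [Fintype k] (e : AddChar k E)
    (δ : k → Wq E abs na F) (t : k → E) {n : ℕ} {f : Wq E abs na F →₀ Polynomial E}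
    (hf : ∀ γ, (f γ).degree ≤ (n : WithBot ℕ)) (γ : Wq E abs na F) :
    (residueMul e δ t f γ).degree ≤ (n : WithBot ℕ) := by
  rw [residueMul_apply, ← Polynomial.mem_degreeLE]
  exact Submodule.sum_mem _ fun y _ =>
    Submodule.smul_mem _ _ (Polynomial.mem_degreeLE.2 (hf _))

theorem abs_eval_residueMul_le {k : Type} [Field k] [Fintype k] (e : AddChar k E)
    (δ : k → Wq E abs na F) (t : k → E) (f : Wq E abs na F →₀ Polynomial E)
    {G M : ℝ} (hM : 0 ≤ M) (hG : ∀ y, abs (fourierCoeff e t y) ≤ G) (v : E)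
    (hf : ∀ γ, abs ((f γ).eval v) ≤ M) (γ : Wq E abs na F) :
    abs ((residueMul e δ t f γ).eval v) ≤ G * M := by
  have hG0 : 0 ≤ G := (abs.nonneg _).trans (hG 0)
  rw [residueMul_apply, Polynomial.eval_finsetSum]
  refine abs_sum_le na _ _ (by positivity) fun y _ => ?_
  rw [Polynomial.eval_smul, smul_eq_mul, abs.map_mul]
  exact mul_le_mul (hG y) (hf _) (abs.nonneg _) hG0

theorem push_residueMul [CharZero E] (hπ1 : abs (π : E) < 1)
    {k : Type} [Field k] [Fintype k] {e : AddChar k E} (he : e.IsPrimitive)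
    {δ : k → Wq E abs na F} (hδ : ∀ y, pmulW E abs na F π hπ1.le (δ y) = 0)
    (t : k → E) (f : Wq E abs na F →₀ Polynomial E) :
    push hπ1 (residueMul e δ t f) = t 0 • push hπ1 f := by
  rw [← sum_fourierCoeff_mul he t 0, Finset.sum_smul, residueMul, LinearMap.sum_apply, map_sum]
  refine Finset.sum_congr rfl fun y _ => ?_
  rw [LinearMap.smul_apply, map_smul, push_shift hπ1 (hδ y), mul_zero,
    AddChar.map_zero_eq_one, mul_one]

end ResidueField

section LevelSeries

variable {E}
variable {abs : AbsoluteValue E ℝ} {na : ∀ x y : E, abs (x + y) ≤ max (abs x) (abs y)}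
  {F : Subfield E} {π : F}

/-- The coefficients of `f` are bounded by `M` on the discs of level `k`: the polynomial
`f γ` on the disc of all `-u` with `π ^ k * u` in the class `γ`. -/
def DiscBound (π : F) (k : ℤ) (f : Wq E abs na F →₀ Polynomial E) (M : ℝ) : Prop :=
  ∀ u : F, abs ((f (mkW E abs na F (π ^ k * u))).eval (-(u : E))) ≤ M

theorem DiscBound.mono {k : ℤ} {f : Wq E abs na F →₀ Polynomial E} {M N : ℝ}
    (hf : DiscBound π k f M) (h : M ≤ N) : DiscBound π k f N :=
  fun u => (hf u).trans h

theorem DiscBound.zero {k : ℤ} {M : ℝ} (hM : 0 ≤ M) :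
    DiscBound π k (0 : Wq E abs na F →₀ Polynomial E) M :=
  fun u => by simpa using hM

theorem DiscBound.add {k : ℤ} {f g : Wq E abs na F →₀ Polynomial E} {M : ℝ}
    (hf : DiscBound π k f M) (hg : DiscBound π k g M) : DiscBound π k (f + g) M := fun u => by
  rw [Finsupp.add_apply, Polynomial.eval_add]
  exact (na _ _).trans (max_le (hf u) (hg u))

theorem DiscBound.sub {k : ℤ} {f g : Wq E abs na F →₀ Polynomial E} {M : ℝ}
    (hf : DiscBound π k f M) (hg : DiscBound π k g M) : DiscBound π k (f - g) M := fun u => by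
  rw [Finsupp.sub_apply, Polynomial.eval_sub]
  exact (abs_sub_le_max na _ _).trans (max_le (hf u) (hg u))

theorem DiscBound.smul {k : ℤ} {f : Wq E abs na F →₀ Polynomial E} {M : ℝ}
    (hf : DiscBound π k f M) (c : E) : DiscBound π k (c • f) (abs c * M) := fun u => by
  rw [Finsupp.smul_apply, Polynomial.eval_smul, smul_eq_mul, abs.map_mul]
  exact mul_le_mul_of_nonneg_left (hf u) (abs.nonneg _)

theorem DiscBound.nonneg {k : ℤ} {f : Wq E abs na F →₀ Polynomial E} {M : ℝ}
    (hf : DiscBound π k f M) : 0 ≤ M := (abs.nonneg _).trans (hf 0)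

theorem discBound_push_of_const (hπ1 : abs (π : E) < 1) (hπ0 : π ≠ 0) {q : ℕ} (hq : 0 < q)
    (hcard : ∀ γ : Wq E abs na F,
      Nat.card {β : Wq E abs na F // pmulW E abs na F π hπ1.le β = γ} = q)
    {k : ℤ} {f : Wq E abs na F →₀ Polynomial E} {M : ℝ} (hM : DiscBound π k f M)
    (hf : ∀ γ δ, pmulW E abs na F π hπ1.le γ = pmulW E abs na F π hπ1.le δ → f γ = f δ) :
    DiscBound π (k + 1) (push hπ1 f) (abs (q : E) * M) := fun u => by
  have h : π ^ (k + 1) * u = π * (π ^ k * u) := by rw [zpow_add_one₀ hπ0]; ring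
  rw [h, ← pmulW_mkW hπ1.le, push_apply_of_const hπ1 hq hcard hf, Polynomial.eval_smul,
    smul_eq_mul, abs.map_mul]
  exact mul_le_mul_of_nonneg_left (hM u) (abs.nonneg _)

theorem discBound_push (hπ1 : abs (π : E) < 1) (hπ0 : π ≠ 0) {n : ℕ}
    {t : Fin (n + 1) → F} (ht1 : ∀ i, abs (t i : E) ≤ 1)
    (ht : ∀ i j, i ≠ j → abs ((t i - t j : F) : E) = 1)
    {k : ℤ} {f : Wq E abs na F →₀ Polynomial E} {M : ℝ} (hM : DiscBound π k f M)
    (hf : ∀ γ, (f γ).degree ≤ (n : WithBot ℕ)) :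
    DiscBound π (k + 1) (push hπ1 f) (M * (abs (π : E))⁻¹ ^ n) := fun u => by
  have hp : 0 < abs (π : E) := abs.pos (by simpa using hπ0)
  have hk : 0 < abs (π : E) ^ (-k) := zpow_pos hp _
  refine abs_eval_push_le hπ1 f _ _ (mul_nonneg hM.nonneg (by positivity)) fun δ hδ => ?_
  obtain ⟨u', rfl⟩ := exists_mkW_zpow_mul hπ0 k δ
  rw [pmulW_mkW, mkW_eq_mkW_iff, zpow_add_one₀ hπ0,
    show π * (π ^ k * u') - π ^ k * π * u = π ^ k * (π * (u' - u)) by ring,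
    Subfield.coe_mul, abs.map_mul, abs_coe_zpow, Subfield.coe_mul, abs.map_mul] at hδ
  have hu : abs ((u' - u : F) : E) ≤ abs (π : E) ^ (-k - 1) := by
    rw [zpow_sub_one₀ hp.ne', _root_.zpow_neg, ← mul_inv, ← one_div, le_div_iff₀ (by positivity)]
    linarith
  have hnode : ∀ i, f (mkW E abs na F (π ^ k * u'))
      = f (mkW E abs na F (π ^ k * (u' + π ^ (-k) * t i))) := fun i => by
    congr 1
    rw [mkW_eq_mkW_iff, mul_add, ← mul_assoc (π ^ k), ← zpow_add₀ hπ0, add_neg_cancel, zpow_zero,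
      one_mul, sub_add_cancel_left, Subfield.coe_neg, abs.map_neg]
    exact ht1 i
  have key := abs_eval_le_of_nodes na (x := fun i => -((u' + π ^ (-k) * t i : F) : E))
    (s := abs (π : E) ^ (-k)) (M := M) (R := abs (π : E) ^ (-k - 1)) (u := -(u : E))
    (P := f (mkW E abs na F (π ^ k * u'))) (n := n) hk
  have hR : abs (π : E) ^ (-k - 1) / abs (π : E) ^ (-k) = (abs (π : E))⁻¹ := by
    rw [zpow_sub_one₀ hp.ne']
    field_simp
  rw [hR] at key
  refine key hM.nonneg (fun i j hij => ?_) (hf _) (fun i => ?_) fun i => ?_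
  · have h : -((u' + π ^ (-k) * t i : F) : E) - -((u' + π ^ (-k) * t j : F) : E)
        = ((π ^ (-k) : F) : E) * ((t j - t i : F) : E) := by push_cast; ring
    rw [h, abs.map_mul, abs_coe_zpow, ht j i hij.symm, mul_one]
  · rw [hnode i]
    exact_mod_cast hM (u' + π ^ (-k) * t i)
  · have h : -(u : E) - -((u' + π ^ (-k) * t i : F) : E)
        = ((u' - u : F) : E) + ((π ^ (-k) * t i : F) : E) := by push_cast; ring
    rw [h]
    refine (na _ _).trans (max_le hu ?_)
    rw [Subfield.coe_mul, abs.map_mul, abs_coe_zpow]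
    refine (mul_le_of_le_one_right hk.le (ht1 i)).trans ?_
    exact zpow_le_zpow_right_of_le_one₀ hp hπ1.le (by omega)

/-- A sequence of coefficients, eventually zero to the left, in which each term is, up to a
bounded error, `lam` times the push-forward of the previous one. -/
structure IsLevelSeries (hπ1 : abs (π : E) < 1) (n : ℕ) (lam : E)
    (a : ℤ → Wq E abs na F →₀ Polynomial E) : Prop where
  eventually_zero : ∃ k0 : ℤ, ∀ k < k0, a k = 0
  degree_le : ∀ k γ, (a k γ).degree ≤ (n : WithBot ℕ)
  discBound : ∀ k, DiscBound π k (a k - lam • push hπ1 (a (k - 1)))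
    (abs (π : E) ^ (-((n : ℤ) * k)))

theorem IsLevelSeries.zero (hπ1 : abs (π : E) < 1) (n : ℕ) (lam : E) :
    IsLevelSeries hπ1 n lam (fun _ => (0 : Wq E abs na F →₀ Polynomial E)) where
  eventually_zero := ⟨0, fun _ _ => rfl⟩
  degree_le k γ := by simp
  discBound k := by
    rw [map_zero, smul_zero, sub_zero]
    exact DiscBound.zero (by positivity)

theorem IsLevelSeries.add {hπ1 : abs (π : E) < 1} {n : ℕ} {lam : E}
    {a b : ℤ → Wq E abs na F →₀ Polynomial E} (ha : IsLevelSeries hπ1 n lam a)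
    (hb : IsLevelSeries hπ1 n lam b) : IsLevelSeries hπ1 n lam (fun k => a k + b k) where
  eventually_zero := by
    obtain ⟨k1, h1⟩ := ha.eventually_zero
    obtain ⟨k2, h2⟩ := hb.eventually_zero
    refine ⟨min k1 k2, fun k hk => ?_⟩
    rw [h1 k (hk.trans_le (min_le_left _ _)), h2 k (hk.trans_le (min_le_right _ _)), add_zero]
  degree_le k γ := (Polynomial.degree_add_le _ _).trans
    (max_le (ha.degree_le k γ) (hb.degree_le k γ))
  discBound k := by
    rw [map_add, smul_add, add_sub_add_comm]
    exact (ha.discBound k).add (hb.discBound k)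

/-- If `a + b` is constant on the fibres of multiplication by `π` at the negative levels,
then `a 0 + b 0` is bounded. -/
theorem discBound_add_of_const (hπ1 : abs (π : E) < 1) (hπ0 : π ≠ 0) {q : ℕ} (hq : 0 < q)
    (hq0 : (q : E) ≠ 0)
    (hcard : ∀ γ : Wq E abs na F,
      Nat.card {β : Wq E abs na F // pmulW E abs na F π hπ1.le β = γ} = q)
    {n : ℕ} {t : Fin (n + 1) → F} (ht1 : ∀ i, abs (t i : E) ≤ 1)
    (ht : ∀ i j, i ≠ j → abs ((t i - t j : F) : E) = 1) {lam mu : E}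
    (hlm : abs (lam * mu * (q : E) * (π : E) ^ n) = 1)
    (hl : abs lam ≤ abs ((q : E)⁻¹ * (π : E) ^ (-(n : ℤ))))
    (hm : abs mu ≤ abs ((q : E)⁻¹ * (π : E) ^ (-(n : ℤ))))
    {a b : ℤ → Wq E abs na F →₀ Polynomial E} (ha : IsLevelSeries hπ1 n lam a)
    (hb : IsLevelSeries hπ1 n mu b)
    (hC : ∀ k < 0, ∀ γ δ, pmulW E abs na F π hπ1.le γ = pmulW E abs na F π hπ1.le δ →
      (a k + b k) γ = (a k + b k) δ) :
    DiscBound π 0 (a 0 + b 0) ((abs (q : E))⁻¹ * ((abs (π : E))⁻¹ ^ n)) := by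
  have hp : 0 < abs (π : E) := abs.pos (by simpa using hπ0)
  have hqp : 0 < abs (q : E) := abs.pos hq0
  have hq1 : abs (q : E) ≤ 1 := abs_natCast_le_one na q
  obtain ⟨r, hr⟩ : ∃ r, r = (abs (π : E))⁻¹ ^ n := ⟨_, rfl⟩
  have hr1 : 1 ≤ r := hr ▸ one_le_pow₀ ((one_le_inv₀ hp).2 hπ1.le)
  have hr0 : 0 < r := one_pos.trans_le hr1
  obtain ⟨s, hs⟩ : ∃ s, s = (abs (q : E))⁻¹ := ⟨_, rfl⟩
  have hs1 : 1 ≤ s := hs ▸ (one_le_inv₀ hqp).2 hq1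
  have hs0 : 0 < s := one_pos.trans_le hs1
  have hqs : abs (q : E) * s = 1 := by rw [hs, mul_inv_cancel₀ hqp.ne']
  have hl' : abs lam ≤ s * r := by
    simpa [hs, hr, abs.map_mul] using hl
  have hm' : abs mu ≤ s * r := by
    simpa [hs, hr, abs.map_mul] using hm
  have hlm' : abs (lam * mu) = s * r := by
    have h : abs (lam * mu) * abs (q : E) * abs (π : E) ^ n = 1 := by
      rwa [abs.map_mul, abs.map_mul, map_pow] at hlm
    rw [hs, hr, inv_pow]
    field_simp
    linarith
  have hrz : ∀ k : ℤ, abs (π : E) ^ (-((n : ℤ) * k)) = r ^ k := fun k => by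
    rw [hr, ← zpow_natCast, ← _root_.zpow_mul, _root_.inv_zpow']
  have hmain : ∀ j : ℕ, ∀ k0 : ℤ, (∀ k < k0, a k = 0) → (∀ k < k0, b k = 0) →
      ∀ k < k0 + j, k ≤ 0 → DiscBound π k (a k + b k) (s * r ^ (k + 1)) := by
    intro j
    induction j with
    | zero =>
      intro k0 h1 h2 k hk _
      rw [h1 k (by simpa using hk), h2 k (by simpa using hk), add_zero]
      exact DiscBound.zero (by positivity)
    | succ j ih =>
      intro k0 h1 h2 k hk hk0
      rcases lt_or_ge k (k0 + j) with hlt | hge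
      · exact ih k0 h1 h2 k hlt hk0
      have hb1 := ih k0 h1 h2 (k - 1) (by push_cast at hk; omega) (by omega)
      have hb2 := ih k0 h1 h2 (k - 1 - 1) (by push_cast at hk; omega) (by omega)
      have hdeg : ∀ γ, (((a (k - 1 - 1) + b (k - 1 - 1)) γ).degree ≤ (n : WithBot ℕ)) :=
        fun γ => (Polynomial.degree_add_le _ _).trans
          (max_le (ha.degree_le _ γ) (hb.degree_le _ γ))
      have hdP : ∀ γ, ((a (k - 1) - lam • push hπ1 (a (k - 1 - 1))) γ).degree
          ≤ (n : WithBot ℕ) := fun γ => (Polynomial.degree_sub_le _ _).trans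
        (max_le (ha.degree_le _ γ)
          ((Polynomial.degree_smul_le _ _).trans (degree_push_le hπ1 (ha.degree_le _) γ)))
      have hdQ : ∀ γ, ((b (k - 1) - mu • push hπ1 (b (k - 1 - 1))) γ).degree
          ≤ (n : WithBot ℕ) := fun γ => (Polynomial.degree_sub_le _ _).trans
        (max_le (hb.degree_le _ γ)
          ((Polynomial.degree_smul_le _ _).trans (degree_push_le hπ1 (hb.degree_le _) γ)))
      have hP := (discBound_push hπ1 hπ0 ht1 ht (ha.discBound (k - 1)) hdP).smul mu
      have hQ := (discBound_push hπ1 hπ0 ht1 ht (hb.discBound (k - 1)) hdQ).smul lam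
      have hC1 := (discBound_push_of_const hπ1 hπ0 hq hcard hb1 (hC _ (by omega))).smul (lam + mu)
      have hC2 := (discBound_push hπ1 hπ0 ht1 ht (discBound_push_of_const hπ1 hπ0 hq hcard hb2
        (hC _ (by omega))) (degree_push_le hπ1 hdeg)).smul (lam * mu)
      have hP0 := ha.discBound k
      have hQ0 := hb.discBound k
      simp only [sub_add_cancel, hrz, ← hr] at hP hQ hC1 hC2 hP0 hQ0
      have hrk : 0 < r ^ k := zpow_pos hr0 _
      have e1 : r ^ (k - 1) * r = r ^ k := by rw [← zpow_add_one₀ hr0.ne', sub_add_cancel]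
      have e2 : r ^ (k + 1) = r * r ^ k := by rw [zpow_add_one₀ hr0.ne', mul_comm]
      have b0 : r ^ k ≤ s * r ^ (k + 1) := by
        rw [e2, ← mul_assoc]
        exact le_mul_of_one_le_left hrk.le (one_le_mul_of_one_le_of_one_le hs1 hr1)
      have b1 : ∀ c : E, abs c ≤ s * r → abs c * (r ^ (k - 1) * r) ≤ s * r ^ (k + 1) := by
        intro c hc
        rw [e1, e2, ← mul_assoc]
        exact mul_le_mul_of_nonneg_right hc hrk.le
      have b2 : abs (lam + mu) * (abs (q : E) * (s * r ^ k)) ≤ s * r ^ (k + 1) := by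
        rw [← mul_assoc (abs (q : E)), hqs, one_mul, e2, ← mul_assoc]
        exact mul_le_mul_of_nonneg_right ((na _ _).trans (max_le hl' hm')) hrk.le
      have b3 : abs (lam * mu) * (abs (q : E) * (s * r ^ (k - 1)) * r) ≤ s * r ^ (k + 1) := by
        rw [← mul_assoc (abs (q : E)), hqs, one_mul]
        exact b1 _ hlm'.le
      have hid : a k + b k = (a k - lam • push hπ1 (a (k - 1)))
          + (b k - mu • push hπ1 (b (k - 1)))
          + (lam + mu) • push hπ1 (a (k - 1) + b (k - 1))
          - (mu • push hπ1 (a (k - 1) - lam • push hπ1 (a (k - 1 - 1)))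
            + lam • push hπ1 (b (k - 1) - mu • push hπ1 (b (k - 1 - 1))))
          - (lam * mu) • push hπ1 (push hπ1 (a (k - 1 - 1) + b (k - 1 - 1))) := by
        simp only [map_add, map_sub, map_smul]
        module
      rw [hid]
      exact ((((hP0.mono b0).add (hQ0.mono b0)).add (hC1.mono b2)).sub
        ((hP.mono (b1 _ hm')).add (hQ.mono (b1 _ hl')))).sub (hC2.mono b3)
  obtain ⟨k1, h1⟩ := ha.eventually_zero
  obtain ⟨k2, h2⟩ := hb.eventually_zero
  have h := hmain (1 - min k1 k2).toNat (min k1 k2)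
    (fun k hk => h1 k (hk.trans_le (min_le_left _ _)))
    (fun k hk => h2 k (hk.trans_le (min_le_right _ _))) 0 (by omega) le_rfl
  rwa [zero_add, zpow_one, hr, hs] at h

theorem exists_bounds {L M Q G H : ℝ} (hL : 0 < L) (hQ : 0 < Q)
    (hH : 0 ≤ H) (hGH : G * H = Q) (hLM : L * M * Q = 1) (hLQ : L * Q ≤ 1) (hMQ : M * Q ≤ 1) :
    ∃ x y : ℝ, 1 ≤ x ∧ 1 ≤ y ∧ L * Q * x ≤ x ∧ M * Q * y ≤ y ∧ G ≤ Q * x ∧ H ≤ Q * y ∧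
      G * M * y ≤ x ∧ H * L * x ≤ y := by
  have hH0 : 0 < H := lt_of_le_of_ne hH (by rintro rfl; simp at hGH; exact hQ.ne hGH)
  have hHL : 0 < H * L := mul_pos hH0 hL
  obtain ⟨x, hx⟩ : ∃ x, x = max (max 1 (G / Q)) (max (1 / (H * L)) (1 / (L * Q))) := ⟨_, rfl⟩
  have h1 : 1 ≤ x := hx ▸ (le_max_left _ _).trans (le_max_left _ _)
  have h2 : G / Q ≤ x := hx ▸ (le_max_right _ _).trans (le_max_left _ _)
  have h3 : 1 / (H * L) ≤ x := hx ▸ (le_max_left _ _).trans (le_max_right _ _)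
  have h4 : 1 / (L * Q) ≤ x := hx ▸ (le_max_right _ _).trans (le_max_right _ _)
  rw [div_le_iff₀ hQ] at h2
  rw [div_le_iff₀ hHL] at h3
  rw [div_le_iff₀ (mul_pos hL hQ)] at h4
  have hx0 : 0 ≤ x := zero_le_one.trans h1
  refine ⟨x, H * L * x, h1, by linarith, mul_le_of_le_one_left hx0 hLQ,
    mul_le_of_le_one_left (by positivity) hMQ, by linarith, ?_, ?_, le_rfl⟩
  · calc H = H * 1 := (mul_one H).symm
      _ ≤ H * (x * (L * Q)) := mul_le_mul_of_nonneg_left h4 hH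
      _ = Q * (H * L * x) := by ring
  · have : G * M * (H * L * x) = (L * M * (G * H)) * x := by ring
    rw [this, hGH, hLM, one_mul]

theorem IsLevelSeries.abs_eval_sub_le {hπ1 : abs (π : E) < 1} (hπ0 : π ≠ 0) {lam : E}
    {a : ℤ → Wq E abs na F →₀ Polynomial E} (ha : IsLevelSeries hπ1 0 lam a)
    (k : ℤ) (γ : Wq E abs na F) :
    abs (((a k - lam • push hπ1 (a (k - 1))) γ).eval 0) ≤ 1 := by
  obtain ⟨u, rfl⟩ := exists_mkW_zpow_mul hπ0 k γ
  have h := ha.discBound k u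
  have hd : ((a k - lam • push hπ1 (a (k - 1))) (mkW E abs na F (π ^ k * u))).degree ≤ 0 :=
    (Polynomial.degree_sub_le _ _).trans (max_le (ha.degree_le k _)
      ((Polynomial.degree_smul_le _ _).trans (degree_push_le hπ1 (ha.degree_le _) _)))
  rw [Polynomial.eq_C_of_degree_le_zero hd, Polynomial.eval_C] at h ⊢
  simpa using h

theorem abs_eval_le_of_push_le {hπ1 : abs (π : E) < 1} (hπ0 : π ≠ 0) {lam : E}
    {a : ℤ → Wq E abs na F →₀ Polynomial E} (ha : IsLevelSeries hπ1 0 lam a)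
    {k : ℤ} {M N : ℝ} (hM : ∀ γ, abs ((push hπ1 (a (k - 1)) γ).eval 0) ≤ M)
    (h1 : 1 ≤ N) (hN : abs lam * M ≤ N) (γ : Wq E abs na F) :
    abs ((a k γ).eval 0) ≤ N := by
  have h : (a k γ).eval 0 = ((a k - lam • push hπ1 (a (k - 1))) γ).eval 0
      + lam * (push hπ1 (a (k - 1)) γ).eval 0 := by
    simp
  rw [h]
  refine (na _ _).trans (max_le ((ha.abs_eval_sub_le hπ0 k γ).trans h1) ?_)
  rw [abs.map_mul]
  exact (mul_le_mul_of_nonneg_left (hM γ) (abs.nonneg _)).trans hN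

/-- One half of the inductive step: if `a k + θ b k` is constant on the fibres of
multiplication by `π`, the push-forward of `a k` is controlled by the previous level. -/
theorem abs_eval_push_le_of_const [CharZero E] (hπ1 : abs (π : E) < 1) (hπ0 : π ≠ 0)
    {k : Type} [Field k] [Fintype k]
    (hcard : ∀ γ : Wq E abs na F,
      Nat.card {β : Wq E abs na F // pmulW E abs na F π hπ1.le β = γ} = Fintype.card k)
    {e : AddChar k E} (he : e.IsPrimitive)
    {η : k → Wq E abs na F} (hη : ∀ y, pmulW E abs na F π hπ1.le (η y) = 0)
    {θ : MulChar k E} (hθ : θ ≠ 1) {f g : Wq E abs na F →₀ Polynomial E}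
    (hfg : ∀ γ δ, pmulW E abs na F π hπ1.le γ = pmulW E abs na F π hπ1.le δ →
      (f + residueMul e η θ g) γ = (f + residueMul e η θ g) δ)
    {M N R : ℝ} (hf : ∀ γ, abs ((f γ).eval 0) ≤ M) (hg : ∀ γ, abs ((g γ).eval 0) ≤ N)
    (hM : abs (Fintype.card k : E) * M ≤ R) (hN : abs (gaussSum θ e) * N ≤ R)
    (γ : Wq E abs na F) : abs ((push hπ1 f γ).eval 0) ≤ R := by
  have hc : (Fintype.card k : E) ≠ 0 := by exact_mod_cast Fintype.card_ne_zero
  have hcp : 0 < abs (Fintype.card k : E) := abs.pos hc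
  have hpush : push hπ1 f = push hπ1 (f + residueMul e η θ g) := by
    rw [map_add, push_residueMul hπ1 he hη, θ.map_zero, zero_smul, add_zero]
  obtain ⟨b, rfl⟩ := exists_mkW_zpow_mul hπ0 1 γ
  rw [hpush, zpow_one, ← pmulW_mkW hπ1.le,
    push_apply_of_const hπ1 Fintype.card_pos hcard hfg, Polynomial.eval_smul, smul_eq_mul,
    Finsupp.add_apply, Polynomial.eval_add, mul_add]
  refine (na _ _).trans (max_le ?_ ?_)
  · rw [abs.map_mul]
    exact (mul_le_mul_of_nonneg_left (hf _) hcp.le).trans hM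
  · rw [abs.map_mul]
    have hN0 : 0 ≤ N := (abs.nonneg _).trans (hg 0)
    refine (mul_le_mul_of_nonneg_left (abs_eval_residueMul_le e η θ g hN0
      (abs_fourierCoeff_mulChar_le e hθ) 0 hg _) hcp.le).trans ?_
    rw [← mul_assoc, ← mul_assoc, mul_inv_cancel₀ hcp.ne', one_mul]
    exact hN

/-- If `a + θ b` and `θ⁻¹ a + b` are constant on the fibres of multiplication by `π` at the
negative levels, for a nontrivial character `θ`, then `a 0` and `b 0` are bounded
separately. -/
theorem exists_bound_of_const_mulChar [CharZero E] (hπ1 : abs (π : E) < 1) (hπ0 : π ≠ 0)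
    {k : Type} [Field k] [Fintype k]
    (hcard : ∀ γ : Wq E abs na F,
      Nat.card {β : Wq E abs na F // pmulW E abs na F π hπ1.le β = γ} = Fintype.card k)
    {e : AddChar k E} (he : e.IsPrimitive)
    {η : k → Wq E abs na F} (hη : ∀ y, pmulW E abs na F π hπ1.le (η y) = 0)
    {θ : MulChar k E} (hθ : θ ≠ 1) {lam mu : E}
    (hlm : abs (lam * mu * (Fintype.card k : E)) = 1)
    (hl : abs lam * abs (Fintype.card k : E) ≤ 1)
    (hm : abs mu * abs (Fintype.card k : E) ≤ 1) :
    ∃ M : ℝ, ∀ a b : ℤ → Wq E abs na F →₀ Polynomial E,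
      IsLevelSeries hπ1 0 lam a → IsLevelSeries hπ1 0 mu b →
      (∀ l < 0, ∀ γ δ, pmulW E abs na F π hπ1.le γ = pmulW E abs na F π hπ1.le δ →
        (a l + residueMul e η θ (b l)) γ = (a l + residueMul e η θ (b l)) δ) →
      (∀ l < 0, ∀ γ δ, pmulW E abs na F π hπ1.le γ = pmulW E abs na F π hπ1.le δ →
        (b l + residueMul e η (θ⁻¹ : MulChar k E) (a l)) γ
          = (b l + residueMul e η (θ⁻¹ : MulChar k E) (a l)) δ) →
      ∀ γ, abs ((a 0 γ).eval 0) ≤ M ∧ abs ((b 0 γ).eval 0) ≤ M := by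
  have hc : (Fintype.card k : E) ≠ 0 := by exact_mod_cast Fintype.card_ne_zero
  have hcp : 0 < abs (Fintype.card k : E) := abs.pos hc
  have hc1 : abs (Fintype.card k : E) ≤ 1 := abs_natCast_le_one na _
  have hlm' : abs lam * abs mu * abs (Fintype.card k : E) = 1 := by
    rwa [abs.map_mul, abs.map_mul] at hlm
  have hl0 : 0 < abs lam := abs.pos (by rintro rfl; simp at hlm')
  obtain ⟨x, y, hx1, hy1, hLx, hMy, hGx, hHy, hGy, hHx⟩ := exists_bounds hl0
    hcp (abs.nonneg (gaussSum θ⁻¹ e))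
    (abs_gaussSum_mul_abs_gaussSum_inv he hθ) hlm' hl hm
  refine ⟨max x y, fun a b ha hb hf hg => ?_⟩
  obtain ⟨Q, hQ⟩ : ∃ Q, Q = abs (Fintype.card k : E) := ⟨_, rfl⟩
  rw [← hQ] at hcp hc1 hLx hMy hGx hHy
  have stepa : ∀ l : ℤ, (∀ γ, abs ((push hπ1 (a (l - 1)) γ).eval 0) ≤ Q * x) →
      ∀ γ, abs ((a l γ).eval 0) ≤ max 1 (abs lam * (Q * x)) := fun l h γ =>
    abs_eval_le_of_push_le hπ0 ha h (le_max_left _ _) (le_max_right _ _) γ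
  have stepb : ∀ l : ℤ, (∀ γ, abs ((push hπ1 (b (l - 1)) γ).eval 0) ≤ Q * y) →
      ∀ γ, abs ((b l γ).eval 0) ≤ max 1 (abs mu * (Q * y)) := fun l h γ =>
    abs_eval_le_of_push_le hπ0 hb h (le_max_left _ _) (le_max_right _ _) γ
  have hmain : ∀ j : ℕ, ∀ k0 : ℤ, (∀ l < k0, a l = 0) → (∀ l < k0, b l = 0) →
      ∀ l < k0 + j, l < 0 → (∀ γ, abs ((push hπ1 (a l) γ).eval 0) ≤ Q * x) ∧
        ∀ γ, abs ((push hπ1 (b l) γ).eval 0) ≤ Q * y := by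
    intro j
    induction j with
    | zero =>
      intro k0 h1 h2 l hk _
      rw [h1 l (by simpa using hk), h2 l (by simpa using hk), map_zero]
      refine ⟨fun γ => ?_, fun γ => ?_⟩ <;>
      · rw [Finsupp.zero_apply, Polynomial.eval_zero, map_zero]
        positivity
    | succ j ih =>
      intro k0 h1 h2 l hk hk0
      rcases lt_or_ge l (k0 + j) with hlt | hge
      · exact ih k0 h1 h2 l hlt hk0
      obtain ⟨ia, ib⟩ := ih k0 h1 h2 (l - 1) (by push_cast at hk; omega) (by omega)
      have ha' := stepa l ia
      have hb' := stepb l ib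
      have hx0 : 0 ≤ x := zero_le_one.trans hx1
      have hy0 : 0 ≤ y := zero_le_one.trans hy1
      refine ⟨abs_eval_push_le_of_const hπ1 hπ0 hcard he hη hθ (hf l hk0) ha' hb' ?_ ?_,
        abs_eval_push_le_of_const hπ1 hπ0 hcard he hη (inv_ne_one.2 hθ) (hg l hk0) hb' ha'
          ?_ ?_⟩
      · rw [← hQ]
        refine mul_le_mul_of_nonneg_left (max_le hx1 ?_) hcp.le
        linarith
      · rw [mul_max_of_nonneg _ _ (abs.nonneg _), mul_one]
        refine max_le hGx ?_
        nlinarith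
      · rw [← hQ]
        refine mul_le_mul_of_nonneg_left (max_le hy1 ?_) hcp.le
        linarith
      · rw [mul_max_of_nonneg _ _ (abs.nonneg _), mul_one]
        refine max_le hHy ?_
        nlinarith
  obtain ⟨k1, h1⟩ := ha.eventually_zero
  obtain ⟨k2, h2⟩ := hb.eventually_zero
  obtain ⟨ia, ib⟩ := hmain (1 - min k1 k2).toNat (min k1 k2)
    (fun k hk => h1 k (hk.trans_le (min_le_left _ _)))
    (fun k hk => h2 k (hk.trans_le (min_le_right _ _))) (0 - 1) (by omega) (by omega)
  refine fun γ => ⟨(stepa 0 ia γ).trans ((max_le hx1 ?_).trans (le_max_left _ _)),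
    (stepb 0 ib γ).trans ((max_le hy1 ?_).trans (le_max_right _ _))⟩ <;> linarith

end LevelSeries

section Kirillov

variable {E}
variable {abs : AbsoluteValue E ℝ} {na : ∀ x y : E, abs (x + y) ≤ max (abs x) (abs y)}
  {F : Subfield E} {π : F}

theorem extChar_of_ne_zero (χ : Fˣ →* Eˣ) {x : F} (hx : x ≠ 0) :
    extChar E F χ x = (χ (Units.mk0 x hx) : E) := by
  rw [extChar, dif_neg hx]

theorem extChar_mul (χ : Fˣ →* Eˣ) (x y : F) :
    extChar E F χ (x * y) = extChar E F χ x * extChar E F χ y := by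
  by_cases hx : x = 0
  · simp [extChar, hx]
  by_cases hy : y = 0
  · simp [extChar, hy]
  rw [extChar_of_ne_zero χ hx, extChar_of_ne_zero χ hy, extChar_of_ne_zero χ (mul_ne_zero hx hy),
    ← Units.val_mul, ← map_mul, Units.mk0_mul]

theorem extChar_zpow (χ : Fˣ →* Eˣ) (hπ0 : π ≠ 0) (k : ℤ) :
    extChar E F χ (π ^ k) = (χ (Units.mk0 π hπ0) : E) ^ k := by
  rw [extChar_of_ne_zero χ (zpow_ne_zero k hπ0), ← Units.val_zpow_eq_zpow_val, ← map_zpow]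
  congr 2
  ext
  simp

theorem ne_zero_of_abs_eq_zpow (hπ0 : π ≠ 0) {x : F} {k : ℤ}
    (hx : abs (x : E) = abs (π : E) ^ k) : x ≠ 0 := by
  rintro rfl
  rw [← abs_coe_zpow, Subfield.coe_zero, map_zero] at hx
  exact zpow_ne_zero k hπ0 (by simpa using hx.symm)

theorem abs_mul_zpow_neg (hπ0 : π ≠ 0) {x : F} {k : ℤ} (hx : abs (x : E) = abs (π : E) ^ k) :
    abs ((x * π ^ (-k) : F) : E) = 1 := by
  have hp : 0 < abs (π : E) := abs.pos (by simpa using hπ0)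
  rw [Subfield.coe_mul, abs.map_mul, abs_coe_zpow, hx, ← zpow_add₀ hp.ne', add_neg_cancel,
    zpow_zero]

theorem extChar_eq_zpow_mul (χ : Fˣ →* Eˣ) (hπ0 : π ≠ 0) (k : ℤ) (x : F) :
    extChar E F χ x = (χ (Units.mk0 π hπ0) : E) ^ k * extChar E F χ (x * π ^ (-k)) := by
  rw [← extChar_zpow, ← extChar_mul]
  congr 1
  rw [mul_left_comm, ← zpow_add₀ hπ0, add_neg_cancel, zpow_zero, mul_one]

theorem vall_eq (hπ0 : π ≠ 0) (hπ1 : abs (π : E) < 1) {x : F} {k : ℤ}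
    (hx : abs (x : E) = abs (π : E) ^ k) : vall E abs F π x = k := by
  have hp : 0 < abs (π : E) := abs.pos (by simpa using hπ0)
  have h : ∃ k : ℤ, abs (x : E) = abs (π : E) ^ k := ⟨k, hx⟩
  rw [vall, dif_pos h]
  exact zpow_right_injective₀ hp hπ1.ne (h.choose_spec.symm.trans hx)

theorem zpow_le_one_iff (hπ0 : π ≠ 0) (hπ1 : abs (π : E) < 1) (k : ℤ) :
    abs (π : E) ^ k ≤ 1 ↔ 0 ≤ k := by
  have hp : 0 < abs (π : E) := abs.pos (by simpa using hπ0)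
  rw [← zpow_zero (abs (π : E)), zpow_le_zpow_iff_right_of_lt_one₀ hp hπ1]

theorem Fprime0_eq (hπ0 : π ≠ 0) (hπ1 : abs (π : E) < 1) (χ : Fˣ →* Eˣ) {x : F} {k : ℤ}
    (hx : abs (x : E) = abs (π : E) ^ k) (hk : 0 ≤ k) :
    Fprime0 E abs F χ x
      = (χ (Units.mk0 π hπ0) : E) ^ k * extChar E F χ (x * π ^ (-k)) := by
  rw [Fprime0, if_pos (hx ▸ (zpow_le_one_iff hπ0 hπ1 k).2 hk), ← extChar_eq_zpow_mul]

theorem Fsecond0_eq (hπ0 : π ≠ 0) (hπ1 : abs (π : E) < 1) (q : ℕ) (χ : Fˣ →* Eˣ) {x : F} {k : ℤ}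
    (hx : abs (x : E) = abs (π : E) ^ k) (hk : 0 ≤ k) :
    Fsecond0 E abs F π q χ x
      = ((q : E)⁻¹ * (χ (Units.mk0 π hπ0) : E)) ^ k * extChar E F χ (x * π ^ (-k)) := by
  rw [Fsecond0, if_pos (hx ▸ (zpow_le_one_iff hπ0 hπ1 k).2 hk), mul_zpow, mul_assoc,
    ← extChar_eq_zpow_mul, omegaFun, if_neg (ne_zero_of_abs_eq_zpow hπ0 hx), vall_eq hπ0 hπ1 hx,
    _root_.inv_zpow, _root_.zpow_neg]

theorem tauPoly_smul_X_pow (m : ℤ) {n i : ℕ} (hi : i ≤ n) {g : Matrix (Fin 2) (Fin 2) E}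
    (hg : g 1 0 = 0) (s : E) :
    tauPoly E m n g (s • Polynomial.X ^ i)
      = ((g 0 0 * g 1 1) ^ m * s) • (Polynomial.C (g 0 0 ^ (n - i)) *
          (Polynomial.C (g 0 1) + Polynomial.C (g 1 1) * Polynomial.X) ^ i) := by
  rw [tauPoly, Finset.sum_eq_single i]
  · rw [hg]
    simp [mul_smul]
  · intro j _ hj
    simp [Polynomial.coeff_X_pow, hj]
  · intro h
    exact absurd (Finset.mem_range.2 (by omega)) h

/-- `φ` is represented on every annulus by a level series, twisted by the character `χ`. -/
def HasLevelSeries (na : ∀ x y : E, abs (x + y) ≤ max (abs x) (abs y)) {π : F}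
    (hπ1 : abs (π : E) < 1) (ψ : F → E) (χ : Fˣ →* Eˣ) (lam : E) (m : ℤ) (n : ℕ)
    (φ : F → Polynomial E) : Prop :=
  ∃ a : ℤ → Wq E abs na F →₀ Polynomial E, IsLevelSeries hπ1 n (lam * (π : E) ^ m) a ∧
    ∀ (k : ℤ) (x : F), abs (x : E) = abs (π : E) ^ k →
      φ x = ((π : E) ^ (-(k * m)) * extChar E F χ (x * π ^ (-k))) •
        hat abs na ψ (x * π ^ (-k)) (a k)

theorem HasLevelSeries.zero (hπ1 : abs (π : E) < 1) (ψ : F → E) (χ : Fˣ →* Eˣ) (lam : E)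
    (m : ℤ) (n : ℕ) : HasLevelSeries na hπ1 ψ χ lam m n 0 :=
  ⟨fun _ => 0, IsLevelSeries.zero hπ1 n _, fun k x _ => by simp⟩

theorem HasLevelSeries.add {hπ1 : abs (π : E) < 1} {ψ : F → E} {χ : Fˣ →* Eˣ} {lam : E}
    {m : ℤ} {n : ℕ} {φ φ' : F → Polynomial E} (h : HasLevelSeries na hπ1 ψ χ lam m n φ)
    (h' : HasLevelSeries na hπ1 ψ χ lam m n φ') :
    HasLevelSeries na hπ1 ψ χ lam m n (φ + φ') := by
  obtain ⟨a, ha, hφ⟩ := h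
  obtain ⟨b, hb, hφ'⟩ := h'
  refine ⟨fun k => a k + b k, ha.add hb, fun k x hx => ?_⟩
  rw [Pi.add_apply, hφ k x hx, hφ' k x hx, map_add, smul_add]

theorem hasLevelSeries_smul_kirAct (hπ0 : π ≠ 0) (hπ1 : abs (π : E) < 1)
    (hdisc : ∀ x : F, x ≠ 0 → ∃ k : ℤ, abs (x : E) = abs (π : E) ^ k)
    {ψ : F → E} (hψadd : ∀ x y : F, ψ (x + y) = ψ x * ψ y)
    (hψO : ∀ x : F, abs (x : E) ≤ 1 → ψ x = 1) {χ1 χ2 χ : Fˣ →* Eˣ} {m : ℤ} {n : ℕ}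
    (hχ : ∀ x : F, abs (x : E) = 1 → abs (extChar E F χ x) = 1)
    (hnorm : ∀ d : F, d ≠ 0 →
      abs (extChar E F χ1 d * extChar E F χ2 d) * abs (d : E) ^ (2 * m + n) = 1)
    {lam : E} (hlam : lam ≠ 0) {f : F → E} (hf0 : ∀ x : F, 1 < abs (x : E) → f x = 0)
    (hf : ∀ (k : ℤ) (x : F), abs (x : E) = abs (π : E) ^ k → 0 ≤ k →
      f x = lam ^ k * extChar E F χ (x * π ^ (-k)))
    {c : E} (hc : abs c ≤ 1) {g : GL (Fin 2) F}
    (hg : (g : Matrix (Fin 2) (Fin 2) F) 1 0 = 0) {i : ℕ} (hi : i ≤ n) :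
    HasLevelSeries na hπ1 ψ χ lam m n
      (c • kirAct E F χ1 χ2 ψ m n g (fun x => f x • Polynomial.X ^ i)) := by
  have hp : 0 < abs (π : E) := abs.pos (by simpa using hπ0)
  have hπE : (π : E) ≠ 0 := by simpa using hπ0
  obtain ⟨a, ha⟩ : ∃ a, a = (g : Matrix (Fin 2) (Fin 2) F) 0 0 := ⟨_, rfl⟩
  obtain ⟨b, hb⟩ : ∃ b, b = (g : Matrix (Fin 2) (Fin 2) F) 0 1 := ⟨_, rfl⟩
  obtain ⟨d, hd⟩ : ∃ d, d = (g : Matrix (Fin 2) (Fin 2) F) 1 1 := ⟨_, rfl⟩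
  have hdet : a * d ≠ 0 := by
    have h := (Matrix.isUnit_iff_isUnit_det _).1 g.isUnit
    rw [Matrix.det_fin_two, hg, mul_zero, sub_zero, ← ha, ← hd] at h
    exact h.ne_zero
  have ha0 : a ≠ 0 := left_ne_zero_of_mul hdet
  have hd0 : d ≠ 0 := right_ne_zero_of_mul hdet
  have hdp : 0 < abs (d : E) := abs.pos (by simpa using hd0)
  obtain ⟨j, hj⟩ := hdisc (a / d) (div_ne_zero ha0 hd0)
  have hε := abs_mul_zpow_neg hπ0 hj
  have haj : abs (a : E) = abs (d : E) * abs (π : E) ^ j := by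
    rw [← hj, ← abs.map_mul]
    congr 1
    have : (d : E) ≠ 0 := by simpa using hd0
    push_cast
    field_simp
  obtain ⟨κ, hκ⟩ : ∃ κ, κ = c * (extChar E F χ1 d * extChar E F χ2 d) * ((a : E) * (d : E)) ^ m
    * extChar E F χ (a / d * π ^ (-j)) := ⟨_, rfl⟩
  obtain ⟨R, hR⟩ : ∃ R, R = Polynomial.C ((a : E) ^ (n - i)) *
    (Polynomial.C (b : E) + Polynomial.C (d : E) * Polynomial.X) ^ i := ⟨_, rfl⟩
  have hRdeg : R.degree ≤ (n : WithBot ℕ) := by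
    have h1 : (Polynomial.C (b : E) + Polynomial.C (d : E) * Polynomial.X).natDegree ≤ 1 := by
      rw [add_comm]
      exact Polynomial.natDegree_linear_le
    refine Polynomial.degree_le_of_natDegree_le ?_
    rw [hR]
    refine (Polynomial.natDegree_C_mul_le _ _).trans ?_
    refine (Polynomial.natDegree_pow_le_of_le i h1).trans ?_
    omega
  have hκabs : abs κ * (abs (d : E) ^ n * abs (π : E) ^ (-(j * m))) ≤ 1 := by
    have h := hnorm d hd0
    rw [hκ, abs.map_mul, hχ _ hε, mul_one, abs.map_mul, abs.map_mul c, map_zpow₀, abs.map_mul (a : E),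
      haj]
    have h2 : abs c * abs (extChar E F χ1 d * extChar E F χ2 d)
          * (abs (d : E) * abs (π : E) ^ j * abs (d : E)) ^ m
          * (abs (d : E) ^ n * abs (π : E) ^ (-(j * m)))
        = abs c * (abs (extChar E F χ1 d * extChar E F χ2 d) * abs (d : E) ^ (2 * m + n)) := by
      rw [zpow_add₀ hdp.ne', zpow_natCast, two_mul, zpow_add₀ hdp.ne', mul_zpow, mul_zpow,
        _root_.zpow_neg, _root_.zpow_mul]
      have : (abs (π : E) ^ j) ^ m ≠ 0 := (zpow_pos (zpow_pos hp _) _).ne'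
      field_simp
    rw [h2, h, mul_one]
    exact hc
  refine ⟨fun k => if 0 ≤ k + j then Finsupp.single (mkW E abs na F (b / d * π ^ k))
    (((π : E) ^ (k * m) * lam ^ (k + j) * κ) • R) else 0, ⟨⟨-j, fun k hk => ?_⟩, ?_, ?_⟩, ?_⟩
  · exact if_neg (by omega)
  · intro k γ
    split_ifs
    · rw [Finsupp.single_apply]
      split_ifs
      · exact (Polynomial.degree_smul_le _ _).trans hRdeg
      · simp
    · simp
  · intro k
    rcases lt_trichotomy (k + j) 0 with hk | hk | hk
    · rw [if_neg (by omega), if_neg (by omega), map_zero, smul_zero, sub_zero]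
      exact DiscBound.zero (by positivity)
    · rw [if_pos (by omega), if_neg (by omega), map_zero, smul_zero, sub_zero]
      intro u
      rw [Finsupp.single_apply]
      split_ifs with h
      · rw [mkW_eq_mkW_iff] at h
        have hu : abs ((b / d - u : F) : E) ≤ abs (π : E) ^ (-k) := by
          rw [show b / d * π ^ k - π ^ k * u = (b / d - u) * π ^ k by ring, Subfield.coe_mul,
            abs.map_mul, abs_coe_zpow] at h
          rwa [_root_.zpow_neg, ← one_div, le_div_iff₀ (zpow_pos hp _)]
        have hev : R.eval (-(u : E)) = (a : E) ^ (n - i) * ((d : E) * ((b / d - u : F) : E)) ^ i := by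
          have : (d : E) ≠ 0 := by simpa using hd0
          rw [hR]
          simp only [Polynomial.eval_mul, Polynomial.eval_C, Polynomial.eval_pow,
            Polynomial.eval_add, Polynomial.eval_X]
          push_cast
          field_simp
          ring
        have hjk : j = -k := by omega
        have hRabs : abs (R.eval (-(u : E))) ≤ abs (d : E) ^ n * (abs (π : E) ^ (-k)) ^ n := by
          rw [hev, abs.map_mul, map_pow, map_pow, abs.map_mul, haj, hjk]
          calc (abs (d : E) * abs (π : E) ^ (-k)) ^ (n - i)
                * (abs (d : E) * abs ((b / d - u : F) : E)) ^ i
              ≤ (abs (d : E) * abs (π : E) ^ (-k)) ^ (n - i)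
                * (abs (d : E) * abs (π : E) ^ (-k)) ^ i := by gcongr
            _ = _ := by rw [← pow_add, Nat.sub_add_cancel hi, mul_pow]
        rw [hk, zpow_zero, mul_one, Polynomial.eval_smul, smul_eq_mul, abs.map_mul, abs.map_mul,
          map_zpow₀]
        have e1 : abs (π : E) ^ (-((n : ℤ) * k)) = (abs (π : E) ^ (-k)) ^ n := by
          rw [← zpow_natCast, ← _root_.zpow_mul]
          congr 1
          ring
        have e2 : abs (π : E) ^ (-(j * m)) = abs (π : E) ^ (k * m) := by rw [hjk]; congr 1; ring
        rw [e1]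
        rw [e2] at hκabs
        calc abs (π : E) ^ (k * m) * abs κ * abs (R.eval (-(u : E)))
            ≤ abs (π : E) ^ (k * m) * abs κ * (abs (d : E) ^ n * (abs (π : E) ^ (-k)) ^ n) :=
              mul_le_mul_of_nonneg_left hRabs (by positivity)
          _ = (abs κ * (abs (d : E) ^ n * abs (π : E) ^ (k * m))) * (abs (π : E) ^ (-k)) ^ n := by
              ring
          _ ≤ _ := mul_le_of_le_one_left (by positivity) hκabs
      · rw [Polynomial.eval_zero, map_zero]
        positivity
    · rw [if_pos (by omega), if_pos (by omega), push_single]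
      have e1 : π * (b / d * π ^ (k - 1)) = b / d * π ^ k := by
        rw [zpow_sub_one₀ hπ0]
        field_simp
      have e2 : (lam * (π : E) ^ m) * ((π : E) ^ ((k - 1) * m) * lam ^ (k - 1 + j) * κ)
          = (π : E) ^ (k * m) * lam ^ (k + j) * κ := by
        rw [show k + j = (k - 1 + j) + 1 by ring, zpow_add_one₀ hlam,
          show k * m = (k - 1) * m + m by ring, zpow_add₀ hπE]
        ring
      rw [e1, Finsupp.smul_single, smul_smul, e2, sub_self]
      exact DiscBound.zero (by positivity)
  · intro k x hx
    have hx1 := abs_mul_zpow_neg hπ0 hx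
    have hax : abs ((a / d * x : F) : E) = abs (π : E) ^ (k + j) := by
      rw [Subfield.coe_mul, abs.map_mul, hj, hx, ← zpow_add₀ hp.ne', add_comm]
    have hkir : (c • kirAct E F χ1 χ2 ψ m n g (fun x => f x • Polynomial.X ^ i)) x
        = (c * ((extChar E F χ1 d * extChar E F χ2 d) *
          (((a : E) * (d : E)) ^ m * (ψ (b / d * x) * f (a / d * x))))) • R := by
      rw [Pi.smul_apply, kirAct, smul_smul (ψ _), tauPoly_smul_X_pow m hi (by simp [matE, hg]), hR,
        ha, hb, hd, smul_smul, smul_smul]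
      simp only [matE, mul_assoc]
    rw [hkir]
    dsimp only
    split_ifs with hk
    · rw [hat_single hψadd hψO _ _ hx1.le, hf _ _ hax hk, smul_smul, smul_smul, hκ]
      have e1 : b / d * π ^ k * (x * π ^ (-k)) = b / d * x := by
        rw [_root_.zpow_neg]
        field_simp
      have e2 : a / d * x * π ^ (-(k + j)) = (a / d * π ^ (-j)) * (x * π ^ (-k)) := by
        rw [neg_add, zpow_add₀ hπ0]
        ring
      have e3 : (π : E) ^ (-(k * m)) * (π : E) ^ (k * m) = 1 := by
        rw [← zpow_add₀ hπE, neg_add_cancel, zpow_zero]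
      rw [e1, e2, extChar_mul]
      congr 1
      linear_combination (-(c * (extChar E F χ1 d * extChar E F χ2 d) * ((a : E) * (d : E)) ^ m *
        ψ (b / d * x) * lam ^ (k + j) * extChar E F χ (a / d * π ^ (-j)) *
        extChar E F χ (x * π ^ (-k)))) * e3
    · rw [hf0 (a / d * x), mul_zero, mul_zero, mul_zero, mul_zero, zero_smul, map_zero, smul_zero]
      rw [hax, ← not_le, zpow_le_one_iff hπ0 hπ1]
      exact hk

end Kirillov

section Expansion

variable {E}
variable {abs : AbsoluteValue E ℝ} {na : ∀ x y : E, abs (x + y) ≤ max (abs x) (abs y)}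
  {F : Subfield E} {π : F}

theorem abs_extChar_mul_eq_one (hπ0 : π ≠ 0)
    (hdisc : ∀ x : F, x ≠ 0 → ∃ k : ℤ, abs (x : E) = abs (π : E) ^ k)
    {χ1 χ2 : Fˣ →* Eˣ}
    (hχ1 : ∀ x : F, abs (x : E) = 1 → abs (extChar E F χ1 x) = 1)
    (hχ2 : ∀ x : F, abs (x : E) = 1 → abs (extChar E F χ2 x) = 1) {m : ℤ} {n q : ℕ}
    (hq0 : (q : E) ≠ 0)
    (h : abs ((χ1 (Units.mk0 π hπ0) : E) * (π : E) ^ m *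
      ((q : E)⁻¹ * (χ2 (Units.mk0 π hπ0) : E) * (π : E) ^ m) * (q : E) * (π : E) ^ n) = 1)
    {d : F} (hd : d ≠ 0) :
    abs (extChar E F χ1 d * extChar E F χ2 d) * abs (d : E) ^ (2 * m + n) = 1 := by
  have hπE : (π : E) ≠ 0 := by simpa using hπ0
  obtain ⟨j, hj⟩ := hdisc d hd
  have h1 := abs_mul_zpow_neg hπ0 hj
  rw [abs.map_mul, extChar_eq_zpow_mul χ1 hπ0 j d, extChar_eq_zpow_mul χ2 hπ0 j d, abs.map_mul,
    abs.map_mul, hχ1 _ h1, hχ2 _ h1, mul_one, mul_one, hj, ← map_zpow₀, ← map_zpow₀,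
    ← abs.map_mul, ← abs.map_mul]
  have e : (χ1 (Units.mk0 π hπ0) : E) ^ j * (χ2 (Units.mk0 π hπ0) : E) ^ j *
      ((π : E) ^ j) ^ (2 * m + n)
      = ((χ1 (Units.mk0 π hπ0) : E) * (π : E) ^ m *
      ((q : E)⁻¹ * (χ2 (Units.mk0 π hπ0) : E) * (π : E) ^ m) * (q : E) * (π : E) ^ n) ^ j := by
    have e1 : (χ1 (Units.mk0 π hπ0) : E) * (π : E) ^ m *
        ((q : E)⁻¹ * (χ2 (Units.mk0 π hπ0) : E) * (π : E) ^ m) * (q : E) * (π : E) ^ n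
        = (χ1 (Units.mk0 π hπ0) : E) * (χ2 (Units.mk0 π hπ0) : E) * (π : E) ^ (2 * m + n) := by
      rw [zpow_add₀ hπE, two_mul, zpow_add₀ hπE, zpow_natCast]
      field_simp
    rw [e1, mul_zpow, mul_zpow, ← _root_.zpow_mul, ← _root_.zpow_mul, mul_comm j]
  rw [e, map_zpow₀, h, _root_.one_zpow]

theorem exists_hasLevelSeries_add (hπ0 : π ≠ 0) (hπ1 : abs (π : E) < 1)
    (hdisc : ∀ x : F, x ≠ 0 → ∃ k : ℤ, abs (x : E) = abs (π : E) ^ k)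
    {ψ : F → E} (hψadd : ∀ x y : F, ψ (x + y) = ψ x * ψ y)
    (hψO : ∀ x : F, abs (x : E) ≤ 1 → ψ x = 1) {χ1 χ2 : Fˣ →* Eˣ} {m : ℤ} {n q : ℕ}
    (hq0 : (q : E) ≠ 0)
    (hχ1 : ∀ x : F, abs (x : E) = 1 → abs (extChar E F χ1 x) = 1)
    (hχ2 : ∀ x : F, abs (x : E) = 1 → abs (extChar E F χ2 x) = 1)
    (hnorm : ∀ d : F, d ≠ 0 →
      abs (extChar E F χ1 d * extChar E F χ2 d) * abs (d : E) ^ (2 * m + n) = 1)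
    {φ : F → Polynomial E}
    (hφ : φ ∈ OESpan E abs (kirAct E F χ1 χ2 ψ m n)
      (fun b => (b : Matrix (Fin 2) (Fin 2) F) 1 0 = 0)
      {φ0 | ∃ i : Fin (n + 1),
        φ0 = (fun x : F => Fprime0 E abs F χ1 x • (Polynomial.X ^ (i : ℕ) : Polynomial E)) ∨
        φ0 = (fun x : F => Fsecond0 E abs F π q χ2 x •
          (Polynomial.X ^ (i : ℕ) : Polynomial E))}) :
    ∃ φ1 φ2 : F → Polynomial E, φ = φ1 + φ2 ∧
      HasLevelSeries na hπ1 ψ χ1 (χ1 (Units.mk0 π hπ0) : E) m n φ1 ∧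
      HasLevelSeries na hπ1 ψ χ2 ((q : E)⁻¹ * (χ2 (Units.mk0 π hπ0) : E)) m n φ2 := by
  obtain ⟨N, c, g, w, hc, hg, hw, rfl⟩ := hφ
  refine Finset.sum_induction _ (fun φ => ∃ φ1 φ2 : F → Polynomial E, φ = φ1 + φ2 ∧
      HasLevelSeries na hπ1 ψ χ1 (χ1 (Units.mk0 π hπ0) : E) m n φ1 ∧
      HasLevelSeries na hπ1 ψ χ2 ((q : E)⁻¹ * (χ2 (Units.mk0 π hπ0) : E)) m n φ2) ?_ ?_ ?_
  · rintro _ _ ⟨φ1, φ2, rfl, h1, h2⟩ ⟨φ1', φ2', rfl, h1', h2'⟩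
    exact ⟨φ1 + φ1', φ2 + φ2', by abel, h1.add h1', h2.add h2'⟩
  · exact ⟨0, 0, (add_zero 0).symm, HasLevelSeries.zero .., HasLevelSeries.zero ..⟩
  · intro j _
    obtain ⟨i, hi | hi⟩ := hw j
    · refine ⟨_, 0, (add_zero _).symm, ?_, HasLevelSeries.zero ..⟩
      rw [hi]
      exact hasLevelSeries_smul_kirAct hπ0 hπ1 hdisc hψadd hψO hχ1 hnorm (Units.ne_zero _)
        (fun x hx => if_neg hx.not_ge) (fun k x hx hk => Fprime0_eq hπ0 hπ1 χ1 hx hk) (hc j)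
        (hg j) (by omega)
    · refine ⟨0, _, (zero_add _).symm, HasLevelSeries.zero .., ?_⟩
      rw [hi]
      exact hasLevelSeries_smul_kirAct hπ0 hπ1 hdisc hψadd hψO hχ2 hnorm
        (mul_ne_zero (inv_ne_zero hq0) (Units.ne_zero _))
        (fun x hx => if_neg hx.not_ge) (fun k x hx hk => Fsecond0_eq hπ0 hπ1 q χ2 hx hk) (hc j)
        (hg j) (by omega)

theorem hat_eq_finsum (ψ : F → E) (x : F) (f : Wq E abs na F →₀ Polynomial E) :
    hat abs na ψ x f = ∑ᶠ β : Wq E abs na F, ψ (Quotient.out β * x) • f β := by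
  rw [hat_apply, Finsupp.sum]
  refine (finsum_eq_sum_of_support_subset _ fun β hβ => ?_).symm
  rw [Finset.mem_coe, Finsupp.mem_support_iff]
  intro h
  exact hβ (by simp [h])

theorem isExpansionOf_of_hat (hπ0 : π ≠ 0) (hπ1 : abs (π : E) < 1) {ψ : F → E}
    {φ : F → Polynomial E} (hφ : ∀ x : F, 1 < abs (x : E) → φ x = 0)
    {c : ℤ → Wq E abs na F →₀ Polynomial E}
    (hc : ∀ (l : ℤ) (x : F), abs (x : E) = abs (π : E) ^ l →
      φ x = hat abs na ψ (x * π ^ (-l)) (c l)) :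
    IsExpansionOf E abs na F π ψ (fun l β => if 0 ≤ l then c l β else 0) φ := by
  refine ⟨⟨0, fun l hl β => if_neg (by omega)⟩, fun l => ?_, fun l x hx => ?_⟩
  · refine (c l).support.finite_toSet.subset fun β hβ => ?_
    rw [Finset.mem_coe, Finsupp.mem_support_iff]
    intro h
    exact hβ (by simp [h])
  · by_cases hl : 0 ≤ l
    · simp only [if_pos hl]
      rw [hc l x hx, hat_eq_finsum]
      refine finsum_congr fun β => ?_
      rw [mul_comm (π ^ (-l)), mul_assoc, mul_comm x]
    · simp only [if_neg hl, smul_zero, finsum_zero]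
      apply hφ
      rw [hx, ← not_le, zpow_le_one_iff hπ0 hπ1]
      exact hl

variable (na) in
/-- On the side of Fourier coefficients, `T` is multiplication by `χ` on the units. -/
structure IsUnitMultiplier (ψ : F → E) (χ : Fˣ →* Eˣ) (n : ℕ)
    (T : (Wq E abs na F →₀ Polynomial E) →ₗ[E] (Wq E abs na F →₀ Polynomial E)) : Prop where
  hat_eq : ∀ f (x : F), abs (x : E) = 1 → hat abs na ψ x (T f) = extChar E F χ x • hat abs na ψ x f
  degree_le : ∀ f : Wq E abs na F →₀ Polynomial E, (∀ γ, (f γ).degree ≤ (n : WithBot ℕ)) →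
    ∀ γ, (T f γ).degree ≤ (n : WithBot ℕ)

/-- For level series whose combination vanishes at the negative levels, the coefficients at
level `0` are bounded, uniformly in the series. -/
def BoundedAtZero (na : ∀ x y : E, abs (x + y) ≤ max (abs x) (abs y)) {π : F}
    (hπ1 : abs (π : E) < 1) (ψ : F → E) (χ1 χ2 : Fˣ →* Eˣ) (n : ℕ) (lam mu : E) : Prop :=
  ∃ T1 T2 : (Wq E abs na F →₀ Polynomial E) →ₗ[E] (Wq E abs na F →₀ Polynomial E),
    IsUnitMultiplier na ψ χ1 n T1 ∧ IsUnitMultiplier na ψ χ2 n T2 ∧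
    ∃ K : Wq E abs na F → ℝ, ∀ a b : ℤ → Wq E abs na F →₀ Polynomial E,
      IsLevelSeries hπ1 n lam a → IsLevelSeries hπ1 n mu b →
      (∀ l < 0, ∀ x : F, abs (x : E) = 1 →
        extChar E F χ1 x • hat abs na ψ x (a l) + extChar E F χ2 x • hat abs na ψ x (b l) = 0) →
      ∀ γ j, abs (((T1 (a 0) + T2 (b 0)) γ).coeff j) ≤ K γ

theorem BoundedAtZero.exists_expansion [CharZero E] {hπ1 : abs (π : E) < 1} (hπ0 : π ≠ 0)
    {ψ : F → E} {χ1 χ2 : Fˣ →* Eˣ} {m : ℤ} {n : ℕ} {lam mu : E}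
    (h : BoundedAtZero na hπ1 ψ χ1 χ2 n (lam * (π : E) ^ m) (mu * (π : E) ^ m)) :
    ∃ M0 : Wq E abs na F → Set (Polynomial E),
      (∀ β, IsLatticeIn E abs n (M0 β)) ∧
      ∀ φ1 φ2 : F → Polynomial E, HasLevelSeries na hπ1 ψ χ1 lam m n φ1 →
        HasLevelSeries na hπ1 ψ χ2 mu m n φ2 →
        (∀ x : F, 1 < abs (x : E) → (φ1 + φ2) x = 0) →
        ∃ C : ℤ → Wq E abs na F → Polynomial E,
          IsExpansionOf E abs na F π ψ C (φ1 + φ2) ∧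
          (∀ l β, (C l β).degree ≤ (n : WithBot ℕ)) ∧ ∀ β, C 0 β ∈ M0 β := by
  obtain ⟨T1, T2, hT1, hT2, K, hK⟩ := h
  have hπE : (π : E) ≠ 0 := by simpa using hπ0
  choose κ hκ0 hκ using fun γ => exists_abs_ge hπE hπ1 (K γ)
  choose M0 hM0 hmem using fun γ => exists_lattice_of_coeff_le abs n (hκ0 γ)
  refine ⟨M0, hM0, ?_⟩
  rintro φ1 φ2 ⟨a, ha, hφ1⟩ ⟨b, hb, hφ2⟩ hφ
  have hdeg : ∀ l γ, ((((π : E) ^ (-(l * m))) • (T1 (a l) + T2 (b l))) γ).degree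
      ≤ (n : WithBot ℕ) := fun l γ => by
    rw [Finsupp.smul_apply, Finsupp.add_apply]
    exact (Polynomial.degree_smul_le _ _).trans ((Polynomial.degree_add_le _ _).trans
      (max_le (hT1.degree_le _ (ha.degree_le l) γ) (hT2.degree_le _ (hb.degree_le l) γ)))
  have hsum : ∀ (l : ℤ) (x : F), abs (x : E) = abs (π : E) ^ l →
      (φ1 + φ2) x = (π : E) ^ (-(l * m)) •
        (extChar E F χ1 (x * π ^ (-l)) • hat abs na ψ (x * π ^ (-l)) (a l)
          + extChar E F χ2 (x * π ^ (-l)) • hat abs na ψ (x * π ^ (-l)) (b l)) := by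
    intro l x hx
    rw [Pi.add_apply, hφ1 l x hx, hφ2 l x hx, smul_add, smul_smul, smul_smul]
  have hneg : ∀ l < 0, ∀ x : F, abs (x : E) = 1 →
      extChar E F χ1 x • hat abs na ψ x (a l) + extChar E F χ2 x • hat abs na ψ x (b l) = 0 := by
    intro l hl x hx
    have hxl : abs ((x * π ^ l : F) : E) = abs (π : E) ^ l := by
      rw [Subfield.coe_mul, abs.map_mul, hx, one_mul, abs_coe_zpow]
    have h := hsum l _ hxl
    rw [hφ, mul_assoc, ← zpow_add₀ hπ0, add_neg_cancel, zpow_zero, mul_one] at h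
    · exact (smul_eq_zero.1 h.symm).resolve_left (zpow_ne_zero _ hπE)
    · rw [hxl, ← not_le, zpow_le_one_iff hπ0 hπ1]
      omega
  refine ⟨_, isExpansionOf_of_hat hπ0 hπ1 hφ
    (c := fun l => ((π : E) ^ (-(l * m))) • (T1 (a l) + T2 (b l))) fun l x hx => ?_, ?_, ?_⟩
  · have hx1 := abs_mul_zpow_neg hπ0 hx
    rw [map_smul, map_add, hT1.hat_eq _ _ hx1, hT2.hat_eq _ _ hx1, hsum l x hx]
  · intro l β
    split_ifs
    · exact hdeg l β
    · simp
  · intro β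
    rw [if_pos le_rfl]
    refine hmem β _ (hdeg 0 β) fun j => ?_
    rw [zero_mul, neg_zero, zpow_zero, one_smul]
    exact (hK a b ha hb hneg β j).trans (hκ β)

end Expansion

section Bounded

variable {E}
variable {abs : AbsoluteValue E ℝ} {na : ∀ x y : E, abs (x + y) ≤ max (abs x) (abs y)}
  {F : Subfield E} {π : F}

theorem exists_coeff_bound_of_discBound {n : ℕ} {t : Fin (n + 1) → F}
    (ht1 : ∀ i, abs (t i : E) ≤ 1) (ht : ∀ i j, i ≠ j → abs ((t i - t j : F) : E) = 1)
    {M : ℝ} (hM : 0 ≤ M) :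
    ∃ K : Wq E abs na F → ℝ, ∀ f : Wq E abs na F →₀ Polynomial E, DiscBound π 0 f M →
      (∀ γ, (f γ).degree ≤ (n : WithBot ℕ)) → ∀ γ j, abs ((f γ).coeff j) ≤ K γ := by
  have hinj : ∀ γ : Wq E abs na F, Function.Injective
      fun i => -((Quotient.out γ + t i : F) : E) := by
    intro γ i j hij
    by_contra hne
    have h := ht i j hne
    have h0 : t i - t j = 0 :=
      sub_eq_zero.2 (add_left_cancel (Subtype.ext (neg_injective hij)))
    simp [h0] at h
  choose K hK using fun γ => exists_coeff_bound_of_nodes na (hinj γ) hM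
  refine ⟨K, fun f hf hd γ j => hK γ (f γ) (hd γ) (fun i => ?_) j⟩
  have h := hf (Quotient.out γ + t i)
  rwa [zpow_zero, one_mul, show mkW E abs na F (Quotient.out γ + t i) = γ from ?_] at h
  conv_rhs => rw [← mkW_out γ]
  rw [mkW_eq_mkW_iff, add_sub_cancel_left]
  exact ht1 i

theorem extChar_eq_one {χ : Fˣ →* Eˣ} (hχ : ∀ u : Fˣ, abs ((u : F) : E) = 1 → χ u = 1)
    {x : F} (hx : abs (x : E) = 1) : extChar E F χ x = 1 := by
  have h0 : x ≠ 0 := by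
    rintro rfl
    simp at hx
  rw [extChar, dif_neg h0, hχ _ hx, Units.val_one]

theorem extChar_eq_mulChar {k : Type} [Field k] {res : F → k} {χ : Fˣ →* Eˣ} {θ : MulChar k E}
    (hθ : ∀ u : Fˣ, abs ((u : F) : E) = 1 → θ (res u) = χ u)
    {x : F} (hx : abs (x : E) = 1) : extChar E F χ x = θ (res x) := by
  have h0 : x ≠ 0 := by
    rintro rfl
    simp at hx
  rw [extChar, dif_neg h0, ← hθ _ hx, Units.val_mk0]

theorem boundedAtZero_of_unramified (hπ0 : π ≠ 0) (hπ1 : abs (π : E) < 1)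
    (hsmall : ∀ x : F, abs (x : E) < 1 → abs (x : E) ≤ abs (π : E))
    {q : ℕ} (hq : 0 < q) (hq0 : (q : E) ≠ 0)
    (hcard : ∀ γ : Wq E abs na F,
      Nat.card {β : Wq E abs na F // pmulW E abs na F π hπ1.le β = γ} = q)
    {ψ : F → E} (hψadd : ∀ x y : F, ψ (x + y) = ψ x * ψ y)
    (hψO : ∀ x : F, abs (x : E) ≤ 1 → ψ x = 1)
    (hψann : ∀ b : F, 1 < abs (b : E) → ∃ x : F, abs (x : E) ≤ 1 ∧ ψ (b * x) ≠ 1)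
    {χ1 χ2 : Fˣ →* Eˣ} (h1 : ∀ u : Fˣ, abs ((u : F) : E) = 1 → χ1 u = 1)
    (h2 : ∀ u : Fˣ, abs ((u : F) : E) = 1 → χ2 u = 1) {n : ℕ} (hn : n < q) {lam mu : E}
    (hlm : abs (lam * mu * (q : E) * (π : E) ^ n) = 1)
    (hl : abs lam ≤ abs ((q : E)⁻¹ * (π : E) ^ (-(n : ℤ))))
    (hm : abs mu ≤ abs ((q : E)⁻¹ * (π : E) ^ (-(n : ℤ)))) :
    BoundedAtZero na hπ1 ψ χ1 χ2 n lam mu := by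
  obtain ⟨k, _, res, hres⟩ := exists_isResidueMap na F
  obtain ⟨t, ht1, ht⟩ := exists_nodes na hres (n := n)
    (by rw [card_residue (na := na) hπ0 hπ1 hsmall hres, hcard]; exact hn)
  obtain ⟨K, hK⟩ := exists_coeff_bound_of_discBound (na := na) (π := π) ht1 ht
    (M := (abs (q : E))⁻¹ * ((abs (π : E))⁻¹ ^ n)) (by positivity)
  refine ⟨LinearMap.id, LinearMap.id, ⟨fun f x hx => ?_, fun f hf => hf⟩,
    ⟨fun f x hx => ?_, fun f hf => hf⟩, K, fun a b ha hb hab γ j => ?_⟩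
  · rw [extChar_eq_one h1 hx, one_smul, LinearMap.id_apply]
  · rw [extChar_eq_one h2 hx, one_smul, LinearMap.id_apply]
  · refine hK _ (discBound_add_of_const hπ1 hπ0 hq hq0 hcard ht1 ht hlm hl hm ha hb
      fun l hl γ δ hγδ => ?_) (fun γ => (Polynomial.degree_add_le _ _).trans
        (max_le (ha.degree_le 0 γ) (hb.degree_le 0 γ))) γ j
    refine apply_eq_of_hat_eq_zero_on_units hπ0 hπ1 hsmall hψadd hψO hψann
      (fun x hx => ?_) hγδ
    have h := hab l hl x hx
    rwa [extChar_eq_one h1 hx, extChar_eq_one h2 hx, one_smul, one_smul, ← map_add] at h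

theorem abs_coeff_le_of_degree_le_zero {P : Polynomial E} (hP : P.degree ≤ ((0 : ℕ) : WithBot ℕ))
    {v : E} {M : ℝ} (hM : abs (P.eval v) ≤ M) (j : ℕ) : abs (P.coeff j) ≤ M := by
  rw [Polynomial.eq_C_of_degree_le_zero hP] at hM ⊢
  rw [Polynomial.eval_C] at hM
  rw [Polynomial.coeff_C]
  split_ifs
  · exact hM
  · rw [map_zero]
    exact (abs.nonneg _).trans hM

theorem abs_eval_residueMul_le_sum {k : Type} [Field k] [Fintype k] (e : AddChar k E)
    (δ : k → Wq E abs na F) (t : k → E) (f : Wq E abs na F →₀ Polynomial E) {M : ℝ}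
    (hM : 0 ≤ M) (v : E) (hf : ∀ γ, abs ((f γ).eval v) ≤ M) (γ : Wq E abs na F) :
    abs ((residueMul e δ t f γ).eval v) ≤ (∑ y, abs (fourierCoeff e t y)) * M :=
  abs_eval_residueMul_le e δ t f hM
    (fun y => Finset.single_le_sum (f := fun y => abs (fourierCoeff e t y))
      (fun _ _ => abs.nonneg _) (Finset.mem_univ y)) v hf γ

theorem exists_eval_bound_of_mulChar [CharZero E] (hπ0 : π ≠ 0) (hπ1 : abs (π : E) < 1)
    (hsmall : ∀ x : F, abs (x : E) < 1 → abs (x : E) ≤ abs (π : E))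
    {ψ : F → E} (hψadd : ∀ x y : F, ψ (x + y) = ψ x * ψ y)
    (hψO : ∀ x : F, abs (x : E) ≤ 1 → ψ x = 1)
    (hψann : ∀ b : F, 1 < abs (b : E) → ∃ x : F, abs (x : E) ≤ 1 ∧ ψ (b * x) ≠ 1)
    {k : Type} [Field k] [Fintype k] {res : F → k} (hres : IsResidueMap abs F res)
    (hcard : ∀ γ : Wq E abs na F,
      Nat.card {β : Wq E abs na F // pmulW E abs na F π hπ1.le β = γ} = Fintype.card k)
    {e : AddChar k E} (he : e.IsPrimitive)
    (heψ : ∀ x : F, abs (x : E) ≤ 1 → e (res x) = ψ (π⁻¹ * x))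
    {lift : k → F} (hlift1 : ∀ y, abs (lift y : E) ≤ 1) (hlift : ∀ y, res (lift y) = y)
    (θ1 θ2 : MulChar k E) {lam mu : E}
    (hlm : abs (lam * mu * (Fintype.card k : E)) = 1)
    (hl : abs lam * abs (Fintype.card k : E) ≤ 1)
    (hm : abs mu * abs (Fintype.card k : E) ≤ 1) :
    ∃ K : ℝ, ∀ a b : ℤ → Wq E abs na F →₀ Polynomial E,
      IsLevelSeries hπ1 0 lam a → IsLevelSeries hπ1 0 mu b →
      (∀ l < 0, ∀ x : F, abs (x : E) = 1 →
        θ1 (res x) • hat abs na ψ x (a l) + θ2 (res x) • hat abs na ψ x (b l) = 0) →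
      ∀ γ, ∃ v, abs (((residueMul e (fun y => mkW E abs na F (π⁻¹ * lift y)) θ1 (a 0)
        + residueMul e (fun y => mkW E abs na F (π⁻¹ * lift y)) θ2 (b 0)) γ).eval v) ≤ K := by
  have hc : (Fintype.card k : E) ≠ 0 := by exact_mod_cast Fintype.card_ne_zero
  have hcp : 0 < abs (Fintype.card k : E) := abs.pos hc
  by_cases hθ : θ1 = θ2
  · subst hθ
    obtain ⟨t, ht1, ht⟩ := exists_nodes na hres (n := 0) Nat.card_pos
    refine ⟨(∑ y, abs (fourierCoeff e θ1 y)) * (abs (Fintype.card k : E))⁻¹,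
      fun a b ha hb hab γ => ⟨0, ?_⟩⟩
    have hD := discBound_add_of_const hπ1 hπ0 Fintype.card_pos hc hcard ht1 ht
      (by simpa using hlm) (by simpa [← one_div, le_div_iff₀ hcp] using hl)
      (by simpa [← one_div, le_div_iff₀ hcp] using hm) ha hb fun l hl γ δ hγδ => ?_
    · rw [← map_add]
      refine abs_eval_residueMul_le_sum e _ _ _ (by positivity) _ (fun β => ?_) γ
      have h := hD (Quotient.out β)
      rw [zpow_zero, one_mul, mkW_out, pow_zero, mul_one] at h
      have hdeg : ((a 0 + b 0) β).degree ≤ ((0 : ℕ) : WithBot ℕ) :=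
        (Polynomial.degree_add_le _ _).trans (max_le (ha.degree_le 0 β) (hb.degree_le 0 β))
      rw [← Polynomial.coeff_zero_eq_eval_zero]
      exact abs_coeff_le_of_degree_le_zero hdeg h 0
    · refine apply_eq_of_hat_eq_zero_on_units hπ0 hπ1 hsmall hψadd hψO hψann
        (fun x hx => ?_) hγδ
      have h := hab l hl x hx
      rw [← smul_add, ← map_add] at h
      refine (smul_eq_zero.1 h).resolve_left fun h0 => ?_
      have := abs_mulChar_eq_one (abs := abs) θ1 ((hres.ne_zero_iff hx.le).2 hx)
      simp [h0] at this
  · have hθ' : θ2 * θ1⁻¹ ≠ 1 := fun h => hθ (mul_inv_eq_one.1 h).symm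
    have hη : ∀ y, pmulW E abs na F π hπ1.le (mkW E abs na F (π⁻¹ * lift y)) = 0 := fun y => by
      rw [pmulW_mkW, mul_inv_cancel_left₀ hπ0]
      exact (mkW_eq_mkW_iff (b := 0)).2 (by simpa using hlift1 y)
    have hinv : ∀ θ : MulChar k E, ∀ x : F, abs (x : E) = 1 →
        (θ⁻¹ : MulChar k E) (res x) * θ (res x) = 1 := fun θ x hx => by
      rw [← MulChar.mul_apply, inv_mul_cancel,
        MulChar.one_apply ((hres.ne_zero_iff hx.le).2 hx).isUnit]
    obtain ⟨M, hM⟩ := exists_bound_of_const_mulChar hπ1 hπ0 hcard he hη hθ' hlm hl hm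
    refine ⟨max ((∑ y, abs (fourierCoeff e θ1 y)) * M) ((∑ y, abs (fourierCoeff e θ2 y)) * M),
      fun a b ha hb hab γ => ⟨0, ?_⟩⟩
    have hM' := hM a b ha hb (fun l hl γ δ hγδ => ?_) (fun l hl γ δ hγδ => ?_)
    · have hM0 : 0 ≤ M := (abs.nonneg _).trans (hM' 0).1
      rw [Finsupp.add_apply, Polynomial.eval_add]
      exact (na _ _).trans (max_le_max
        (abs_eval_residueMul_le_sum e _ _ _ hM0 _ (fun β => (hM' β).1) γ)
        (abs_eval_residueMul_le_sum e _ _ _ hM0 _ (fun β => (hM' β).2) γ))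
    · refine apply_eq_of_hat_eq_zero_on_units hπ0 hπ1 hsmall hψadd hψO hψann
        (fun x hx => ?_) hγδ
      have h := congrArg (fun P => (θ1⁻¹ : MulChar k E) (res x) • P) (hab l hl x hx)
      simp only [smul_add, smul_smul, smul_zero, hinv θ1 x hx, one_smul] at h
      rw [map_add, hat_residueMul hψadd hψO hres he heψ hlift1 hlift _ _ hx.le, MulChar.mul_apply,
        mul_comm]
      exact h
    · refine apply_eq_of_hat_eq_zero_on_units hπ0 hπ1 hsmall hψadd hψO hψann
        (fun x hx => ?_) hγδ
      have h := congrArg (fun P => (θ2⁻¹ : MulChar k E) (res x) • P) (hab l hl x hx)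
      simp only [smul_add, smul_smul, smul_zero, hinv θ2 x hx, one_smul] at h
      rw [map_add, hat_residueMul hψadd hψO hres he heψ hlift1 hlift _ _ hx.le, mul_inv, inv_inv,
        MulChar.mul_apply, add_comm]
      exact h

theorem boundedAtZero_of_tame [CharZero E] (hπ0 : π ≠ 0) (hπ1 : abs (π : E) < 1)
    (hsmall : ∀ x : F, abs (x : E) < 1 → abs (x : E) ≤ abs (π : E))
    {q : ℕ} (hq : 0 < q)
    (hcard : ∀ γ : Wq E abs na F,
      Nat.card {β : Wq E abs na F // pmulW E abs na F π hπ1.le β = γ} = q)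
    {ψ : F → E} (hψadd : ∀ x y : F, ψ (x + y) = ψ x * ψ y)
    (hψO : ∀ x : F, abs (x : E) ≤ 1 → ψ x = 1)
    (hψann : ∀ b : F, 1 < abs (b : E) → ∃ x : F, abs (x : E) ≤ 1 ∧ ψ (b * x) ≠ 1)
    {χ1 χ2 : Fˣ →* Eˣ}
    (h1 : ∀ u : Fˣ, abs (((u : F) : E) - 1) ≤ abs (π : E) → χ1 u = 1)
    (h2 : ∀ u : Fˣ, abs (((u : F) : E) - 1) ≤ abs (π : E) → χ2 u = 1) {lam mu : E}
    (hlm : abs (lam * mu * (q : E)) = 1)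
    (hl : abs lam * abs (q : E) ≤ 1) (hm : abs mu * abs (q : E) ≤ 1) :
    (∀ x : F, abs (x : E) = 1 → abs (extChar E F χ1 x) = 1) ∧
      (∀ x : F, abs (x : E) = 1 → abs (extChar E F χ2 x) = 1) ∧
      BoundedAtZero na hπ1 ψ χ1 χ2 0 lam mu := by
  obtain ⟨k, _, res, hres⟩ := exists_isResidueMap na F
  have hkq : Nat.card k = q := by rw [card_residue (na := na) hπ0 hπ1 hsmall hres, hcard]
  have : Finite k := Nat.finite_of_card_ne_zero (by omega)
  have := Fintype.ofFinite k
  obtain rfl : Fintype.card k = q := by rw [← hkq, Nat.card_eq_fintype_card]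
  choose lift hlift1 hlift using hres.surj
  obtain ⟨e, he, heψ⟩ := exists_addChar na hπ0 hπ1 hsmall hψadd hψO hψann hres
  obtain ⟨θ1, hθ1⟩ := exists_mulChar na hsmall h1 hres
  obtain ⟨θ2, hθ2⟩ := exists_mulChar na hsmall h2 hres
  obtain ⟨K, hK⟩ := exists_eval_bound_of_mulChar hπ0 hπ1 hsmall hψadd hψO hψann hres hcard he heψ
    hlift1 hlift θ1 θ2 hlm hl hm
  refine ⟨fun x hx => ?_, fun x hx => ?_,
    residueMul e (fun y => mkW E abs na F (π⁻¹ * lift y)) θ1,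
    residueMul e (fun y => mkW E abs na F (π⁻¹ * lift y)) θ2,
    ⟨fun f x hx => ?_, fun f hf => degree_residueMul_le e _ _ hf⟩,
    ⟨fun f x hx => ?_, fun f hf => degree_residueMul_le e _ _ hf⟩,
    fun _ => K, fun a b ha hb hab γ j => ?_⟩
  · rw [extChar_eq_mulChar hθ1 hx]
    exact abs_mulChar_eq_one θ1 ((hres.ne_zero_iff hx.le).2 hx)
  · rw [extChar_eq_mulChar hθ2 hx]
    exact abs_mulChar_eq_one θ2 ((hres.ne_zero_iff hx.le).2 hx)
  · rw [hat_residueMul hψadd hψO hres he heψ hlift1 hlift _ _ hx.le, extChar_eq_mulChar hθ1 hx]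
  · rw [hat_residueMul hψadd hψO hres he heψ hlift1 hlift _ _ hx.le, extChar_eq_mulChar hθ2 hx]
  · obtain ⟨v, hv⟩ := hK a b ha hb (fun l hl x hx => by
      rw [← extChar_eq_mulChar hθ1 hx, ← extChar_eq_mulChar hθ2 hx]
      exact hab l hl x hx) γ
    refine abs_coeff_le_of_degree_le_zero ?_ hv j
    exact (Polynomial.degree_add_le _ _).trans (max_le
      (degree_residueMul_le e _ _ (ha.degree_le 0) γ)
      (degree_residueMul_le e _ _ (hb.degree_le 0) γ))

end Bounded

/-- Theorem 1.2 of the paper: under the hypotheses of Theorem 1.1, for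
`Λ = Σ_{i=0}^{n} (O_E[B](u^i ⊗ F′₀) + O_E[B](u^i ⊗ F″₀))` inside the Kirillov model `K`,
there are `O_E`-lattices `M₀(β) ⊆ V_τ` such that every `φ ∈ Λ` vanishing outside `O_F` has
an expansion `φ = Σ_{l,β} C_l(β)ψ_β(π^{-l}x)φ_l(x)` with `C₀(β) ∈ M₀(β)` for all `β`. -/
theorem stmt2 [CharZero E] [IsAlgClosed E]
    (abs : AbsoluteValue E ℝ)
    (na : ∀ x y : E, abs (x + y) ≤ max (abs x) (abs y))
    (F : Subfield E) (π : F)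
    (hπ0 : π ≠ 0) (hπ1 : abs (π : E) < 1)
    (hdisc : ∀ x : F, x ≠ 0 → ∃ k : ℤ, abs (x : E) = abs (π : E) ^ k)
    -- the residue field of `F` has `q` elements
    (q : ℕ) (hq : 0 < q)
    (hcard : ∀ γ : Wq E abs na F,
      Nat.card {β : Wq E abs na F // pmulW E abs na F π hπ1.le β = γ} = q)
    -- `ψ` is an additive character of `F`, trivial on `O_F`, under which `O_F` is its own
    -- annihilator:
    (ψ : F → E)
    (hψadd : ∀ x y : F, ψ (x + y) = ψ x * ψ y)
    (hψO : ∀ x : F, abs (x : E) ≤ 1 → ψ x = 1)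
    (hψann : ∀ b : F, 1 < abs (b : E) → ∃ x : F, abs (x : E) ≤ 1 ∧ ψ (b * x) ≠ 1)
    -- smooth characters `χ₁, χ₂` of `F^×`:
    (χ1 χ2 : Fˣ →* Eˣ)
    (m : ℤ) (n : ℕ)
    -- case (1): `χ₁, χ₂` unramified and `n < q`; or case (2): `χ₁, χ₂` tamely ramified
    -- and `n = 0`:
    (hcase :
      ((∀ u : Fˣ, abs ((u : F) : E) = 1 → χ1 u = 1) ∧
       (∀ u : Fˣ, abs ((u : F) : E) = 1 → χ2 u = 1) ∧ n < q) ∨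
      ((∀ u : Fˣ, abs (((u : F) : E) - 1) ≤ abs (π : E) → χ1 u = 1) ∧
       (∀ u : Fˣ, abs (((u : F) : E) - 1) ≤ abs (π : E) → χ2 u = 1) ∧ n = 0))
    -- `χ₁ ≠ ωχ₂`:
    (hneq : ¬ ((∀ u : Fˣ, abs ((u : F) : E) = 1 → χ1 u = χ2 u) ∧
      (q : E) * (χ1 (Units.mk0 π hπ0) : E) = (χ2 (Units.mk0 π hπ0) : E)))
    -- `σ` is irreducible, i.e. `χ₁/(ωχ₂) ≠ ω^{±1}`:
    (hirr1 : χ1 ≠ χ2)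
    (hirr2 : ¬ ((∀ u : Fˣ, abs ((u : F) : E) = 1 → χ1 u = χ2 u) ∧
      (q : E) ^ 2 * (χ1 (Units.mk0 π hπ0) : E) = (χ2 (Units.mk0 π hπ0) : E)))
    -- the Breuil–Schneider conditions:
    (lam mu lamT muT : E)
    (hlam : lam = (χ1 (Units.mk0 π hπ0) : E))
    (hmu : mu = (q : E)⁻¹ * (χ2 (Units.mk0 π hπ0) : E))
    (hlamT : lamT = lam * (π : E) ^ m)
    (hmuT : muT = mu * (π : E) ^ m)
    (hBS1 : abs (lamT * muT * (q : E) * (π : E) ^ (n : ℕ)) = 1)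
    (hBS2 : abs lamT ≤ abs ((q : E)⁻¹ * (π : E) ^ (-(n : ℤ))))
    (hBS3 : abs muT ≤ abs ((q : E)⁻¹ * (π : E) ^ (-(n : ℤ)))) :
    ∃ M0 : Wq E abs na F → Set (Polynomial E),
      (∀ β : Wq E abs na F, IsLatticeIn E abs n (M0 β)) ∧
      ∀ φ : F → Polynomial E,
        -- `φ ∈ Λ = Σ_{i=0}^{n} (O_E[B](u^i ⊗ F′₀) + O_E[B](u^i ⊗ F″₀))`:
        φ ∈ OESpan E abs (kirAct E F χ1 χ2 ψ m n)
            (fun b => (b : Matrix (Fin 2) (Fin 2) F) 1 0 = 0)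
            {φ0 | ∃ i : Fin (n+1),
              φ0 = (fun x : F => Fprime0 E abs F χ1 x •
                      (Polynomial.X ^ (i : ℕ) : Polynomial E)) ∨
              φ0 = (fun x : F => Fsecond0 E abs F π q χ2 x •
                      (Polynomial.X ^ (i : ℕ) : Polynomial E))} →
        -- `φ` vanishes identically outside `O_F`:
        (∀ x : F, 1 < abs (x : E) → φ x = 0) →
        -- `φ` admits an expansion with values in `V_τ` and `C₀(β) ∈ M₀(β)`:
        ∃ C : ℤ → Wq E abs na F → Polynomial E,
          IsExpansionOf E abs na F π ψ C φ ∧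
          (∀ (l : ℤ) (β : Wq E abs na F), (C l β).degree ≤ (n : WithBot ℕ)) ∧
          (∀ β : Wq E abs na F, C 0 β ∈ M0 β) := by
  subst hlamT hmuT hlam hmu
  have hq0 : (q : E) ≠ 0 := Nat.cast_ne_zero.2 hq.ne'
  have hqp : 0 < abs (q : E) := abs.pos hq0
  have hsmall := abs_le_of_abs_lt_one hπ0 hπ1 hdisc
  obtain ⟨hχ1, hχ2, hB⟩ : (∀ x : F, abs (x : E) = 1 → abs (extChar E F χ1 x) = 1) ∧
      (∀ x : F, abs (x : E) = 1 → abs (extChar E F χ2 x) = 1) ∧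
      BoundedAtZero na hπ1 ψ χ1 χ2 n ((χ1 (Units.mk0 π hπ0) : E) * (π : E) ^ m)
        ((q : E)⁻¹ * (χ2 (Units.mk0 π hπ0) : E) * (π : E) ^ m) := by
    rcases hcase with ⟨h1, h2, hn⟩ | ⟨h1, h2, rfl⟩
    · exact ⟨fun x hx => by rw [extChar_eq_one h1 hx, map_one],
        fun x hx => by rw [extChar_eq_one h2 hx, map_one],
        boundedAtZero_of_unramified hπ0 hπ1 hsmall hq hq0 hcard hψadd hψO hψann h1 h2 hn
          hBS1 hBS2 hBS3⟩
    · rw [Nat.cast_zero, neg_zero, zpow_zero, mul_one, map_inv₀,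
        ← one_div (abs (q : E)), le_div_iff₀ hqp] at hBS2 hBS3
      rw [pow_zero, mul_one] at hBS1
      exact boundedAtZero_of_tame hπ0 hπ1 hsmall hq hcard hψadd hψO hψann h1 h2 hBS1 hBS2 hBS3
  obtain ⟨M0, hM0, hM⟩ := hB.exists_expansion hπ0
  refine ⟨M0, hM0, fun φ hφ hφ0 => ?_⟩
  obtain ⟨φ1, φ2, rfl, h1, h2⟩ := exists_hasLevelSeries_add (na := na) hπ0 hπ1 hdisc hψadd hψO
    hq0 hχ1 hχ2 (fun d hd => abs_extChar_mul_eq_one hπ0 hdisc hχ1 hχ2 hq0 hBS1 hd) hφ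
  exact hM φ1 φ2 h1 h2 hφ0

end BS
end
end

section
/- Fix l ∈ ℤ. For β ∈ W let M_l(β) = Span_{O_E}{π^{-l}e₁, e₂ − π^{-l}b e₁} ⊂ E², where b ∈ F is any lift of β (this O_E-module is independent of the lift). Suppose C : W → E² satisfies C(β) ∈ M_l(β) for every β ∈ W, and C(β) = C(β′) whenever β − β′ ∈ W₁ (i.e. C(β) depends only on πβ). Then C(β) ∈ Span_{O_E}{π^{-l}e₁, π(e₂ − π^{-l}b e₁)} for every β ∈ W. -/
open scoped Classical

noncomputable section

namespace BS

variable (E : Type) [Field E]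

/-- Fix `l ∈ ℤ`.  For `β ∈ W` let
`M_l(β) = Span_{O_E}{π^{-l}e₁, e₂ − π^{-l}b e₁} ⊂ E²`, where `b ∈ F` is any lift of `β`.
Suppose `C : W → E²` satisfies `C(β) ∈ M_l(β)` for every `β ∈ W`, and `C(β) = C(β′)`
whenever `β − β′ ∈ W₁` (i.e. `C(β)` depends only on `πβ`).  Then
`C(β) ∈ Span_{O_E}{π^{-l}e₁, π(e₂ − π^{-l}b e₁)}` for every `β ∈ W`. -/
theorem stmt5 (abs : AbsoluteValue E ℝ)
    (na : ∀ x y : E, abs (x + y) ≤ max (abs x) (abs y))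
    (F : Subfield E) (π : F)
    (hπ0 : π ≠ 0) (hπ1 : abs (π : E) < 1)
    (hdisc : ∀ x : F, x ≠ 0 → ∃ k : ℤ, abs (x : E) = abs (π : E) ^ k)
    (l : ℤ)
    (e1 e2 : E × E) (he1 : e1 = (1, 0)) (he2 : e2 = (0, 1))
    (C : Wq E abs na F → E × E)
    -- `C(β) ∈ M_l(β)` for every `β` (membership in the `O_E`-span, for any lift `b` of `β`):
    (hC : ∀ β : Wq E abs na F, ∀ b : F, mkW E abs na F b = β →
      ∃ c d : E, abs c ≤ 1 ∧ abs d ≤ 1 ∧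
        C β = c • (((π : E) ^ (-l) : E) • e1) + d • (e2 - ((π : E) ^ (-l) * (b : E)) • e1))
    -- `C(β)` depends only on `πβ`:
    (hdep : ∀ β β' : Wq E abs na F,
      pmulW E abs na F π hπ1.le β = pmulW E abs na F π hπ1.le β' → C β = C β') :
    ∀ β : Wq E abs na F, ∀ b : F, mkW E abs na F b = β →
      ∃ c d : E, abs c ≤ 1 ∧ abs d ≤ 1 ∧
        C β = c • (((π : E) ^ (-l) : E) • e1) +
          d • ((π : E) • (e2 - ((π : E) ^ (-l) * (b : E)) • e1)) := by
  subst he1 he2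
  intro β b hb
  have hπE : (π : E) ≠ 0 := by simpa using hπ0
  have hpow : (π : E) ^ (-l) ≠ 0 := zpow_ne_zero _ hπE
  obtain ⟨c, d, hc, -, hCβ⟩ := hC β b hb
  obtain ⟨c', d', hc', -, hCβ'⟩ := hC _ (b + π⁻¹) rfl
  -- The classes of `b` and `b + π⁻¹` agree after multiplication by `π`.
  have hW : pmulW E abs na F π hπ1.le β
      = pmulW E abs na F π hπ1.le (mkW E abs na F (b + π⁻¹)) := by
    subst hb
    refine QuotientAddGroup.eq.mpr ?_
    change abs ((-(π * b) + π * (b + π⁻¹) : F) : E) ≤ 1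
    have h : -(π * b) + π * (b + π⁻¹) = 1 := by
      field_simp
      ring
    rw [h]
    simp
  have hEq := (hCβ.symm.trans (hdep _ _ hW)).trans hCβ'
  have hd : d = d' := by simpa using congrArg Prod.snd hEq
  subst hd
  have h1 : c * (π : E) ^ (-l) - d * ((π : E) ^ (-l) * b)
      = c' * (π : E) ^ (-l) - d * ((π : E) ^ (-l) * (b + (π : E)⁻¹)) := by
    simpa [sub_eq_add_neg] using congrArg Prod.fst hEq
  have h2 : d * (π : E)⁻¹ = c' - c := by
    apply mul_left_cancel₀ hpow
    linear_combination h1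
  have h3 : d = (c' - c) * π := by
    rw [← h2, inv_mul_cancel_right₀ hπE]
  refine ⟨c, c' - c, hc, ?_, ?_⟩
  · rw [sub_eq_add_neg]
    refine (na _ _).trans (max_le hc' ?_)
    rwa [abs.map_neg]
  · rw [hCβ, smul_smul (c' - c), ← h3]

end BS
end
end

section
/- Let c : W → E be finitely supported and define φ : O_F → E by φ(x) = Σ_{β∈W} c(β)ψ_β(x). Then φ vanishes identically on U_F if and only if c(β) = c(β′) whenever β − β′ ∈ W₁ (i.e. c(β) depends only on πβ). -/
open scoped Classical

noncomputable section

namespace BS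

variable (E : Type) [Field E]

variable {E} in
/-- The value `ψ (b * x)` at an integral `x` depends only on the class of `b` modulo `O_F`. -/
theorem map_mul_eq_of_mk_eq {abs : AbsoluteValue E ℝ}
    {na : ∀ x y : E, abs (x + y) ≤ max (abs x) (abs y)} {F : Subfield E} {ψ : F → E}
    (hψadd : ∀ x y : F, ψ (x + y) = ψ x * ψ y) (hψO : ∀ x : F, abs (x : E) ≤ 1 → ψ x = 1)
    {b b' : F} (h : (b : Wq E abs na F) = b') {x : F} (hx : abs (x : E) ≤ 1) :
    ψ (b * x) = ψ (b' * x) := by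
  have h1 : abs ((-b + b' : F) : E) ≤ 1 := QuotientAddGroup.eq.1 h
  have h2 : abs (((-b + b') * x : F) : E) ≤ 1 := by
    rw [Subfield.coe_mul, abs.map_mul]
    exact mul_le_one₀ h1 (abs.nonneg _) hx
  rw [show b' * x = b * x + (-b + b') * x by ring, hψadd, hψO _ h2, mul_one]

variable {E} in
/-- The characters `ψ_β` of `O_F` are multiplicative in `β`. -/
theorem map_out_add_mul {abs : AbsoluteValue E ℝ}
    {na : ∀ x y : E, abs (x + y) ≤ max (abs x) (abs y)} {F : Subfield E} {ψ : F → E}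
    (hψadd : ∀ x y : F, ψ (x + y) = ψ x * ψ y) (hψO : ∀ x : F, abs (x : E) ≤ 1 → ψ x = 1)
    (β γ : Wq E abs na F) {x : F} (hx : abs (x : E) ≤ 1) :
    ψ (Quotient.out (β + γ) * x) = ψ (Quotient.out β * x) * ψ (Quotient.out γ * x) := by
  rw [← hψadd, ← add_mul]
  refine map_mul_eq_of_mk_eq (na := na) hψadd hψO ?_ hx
  rw [QuotientAddGroup.mk_add, QuotientAddGroup.out_eq', QuotientAddGroup.out_eq',
    QuotientAddGroup.out_eq']

variable {E} in
/-- Translating the coefficients by `w` multiplies the sum `∑ c(β) ψ_β(x)` by `ψ_w(x)`. -/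
theorem finsum_sub_mul_map_out {abs : AbsoluteValue E ℝ}
    {na : ∀ x y : E, abs (x + y) ≤ max (abs x) (abs y)} {F : Subfield E} {ψ : F → E}
    (hψadd : ∀ x y : F, ψ (x + y) = ψ x * ψ y) (hψO : ∀ x : F, abs (x : E) ≤ 1 → ψ x = 1)
    (c : Wq E abs na F → E) (w : Wq E abs na F)
    {x : F} (hx : abs (x : E) ≤ 1) :
    ∑ᶠ β, c (β - w) * ψ (Quotient.out β * x) =
      (∑ᶠ β, c β * ψ (Quotient.out β * x)) * ψ (Quotient.out w * x) := by
  rw [finsum_mul,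
    ← finsum_comp_equiv (Equiv.addRight w) (f := fun β ↦ c (β - w) * ψ (Quotient.out β * x))]
  refine finsum_congr fun β ↦ ?_
  simp only [Equiv.coe_addRight, add_sub_cancel_right]
  rw [map_out_add_mul hψadd hψO β w hx, mul_assoc]

variable {E} in
/-- The characters `ψ_β` of `O_F` are linearly independent. -/
theorem eq_zero_of_finsum_mul_map_out_eq_zero {abs : AbsoluteValue E ℝ}
    {na : ∀ x y : E, abs (x + y) ≤ max (abs x) (abs y)} {F : Subfield E} {ψ : F → E}
    (hψadd : ∀ x y : F, ψ (x + y) = ψ x * ψ y) (hψO : ∀ x : F, abs (x : E) ≤ 1 → ψ x = 1)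
    (hψann : ∀ b : F, 1 < abs (b : E) → ∃ x : F, abs (x : E) ≤ 1 ∧ ψ (b * x) ≠ 1)
    {c : Wq E abs na F → E} (hc : {β : Wq E abs na F | c β ≠ 0}.Finite)
    (h : ∀ x : F, abs (x : E) ≤ 1 → ∑ᶠ β, c β * ψ (Quotient.out β * x) = 0)
    (β : Wq E abs na F) : c β = 0 := by
  have hψ0 : ψ 0 = 1 := hψO 0 (by simp)
  let χ (β : Wq E abs na F) : Multiplicative (OFadd E abs na F) →* E :=
    { toFun := fun x ↦ ψ (Quotient.out β * (x.toAdd : F))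
      map_one' := by simp [hψ0]
      map_mul' := fun x y ↦ by simp [mul_add, hψadd] }
  have hχ : Function.Injective χ := by
    intro β γ hβγ
    by_contra hne
    have hlt : 1 < abs ((-Quotient.out β + Quotient.out γ : F) : E) := by
      by_contra! hle
      apply hne
      rw [← QuotientAddGroup.out_eq' β, ← QuotientAddGroup.out_eq' γ]
      exact QuotientAddGroup.eq.2 hle
    obtain ⟨x, hx, hx1⟩ := hψann _ hlt
    have hxe : ψ (Quotient.out β * x) = ψ (Quotient.out γ * x) :=
      DFunLike.congr_fun hβγ (Multiplicative.ofAdd (⟨x, hx⟩ : OFadd E abs na F))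
    apply hx1
    rw [add_mul, hψadd, ← hxe, ← hψadd, ← add_mul, neg_add_cancel, zero_mul, hψ0]
  have hli := (linearIndependent_monoidHom (Multiplicative (OFadd E abs na F)) E).comp χ hχ
  rw [linearIndependent_iff'] at hli
  by_contra hβ
  refine hβ (hli hc.toFinset c ?_ β (hc.mem_toFinset.2 hβ))
  funext x
  have hx := h x.toAdd x.toAdd.2
  rw [finsum_eq_sum_of_support_subset (s := hc.toFinset)] at hx
  · simpa [Finset.sum_apply, χ] using hx
  · intro β hβ
    simpa using left_ne_zero_of_mul hβ

/-- for a finitely supported `c : W → E` and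
`φ(x) = Σ_{β∈W} c(β)ψ_β(x)` on `O_F`, `φ` vanishes identically on `U_F` if and only if
`c(β) = c(β′)` whenever `β − β′ ∈ W₁`, i.e. `c(β)` depends only on `πβ`
(Lemma 2.1(i) of the paper). -/
theorem stmt6 [CharZero E]
    (abs : AbsoluteValue E ℝ)
    (na : ∀ x y : E, abs (x + y) ≤ max (abs x) (abs y))
    (F : Subfield E) (π : F)
    (hπ0 : π ≠ 0) (hπ1 : abs (π : E) < 1)
    (hdisc : ∀ x : F, x ≠ 0 → ∃ k : ℤ, abs (x : E) = abs (π : E) ^ k)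
    -- the residue field has `q` elements
    (q : ℕ) (hq : 0 < q)
    (hcard : ∀ γ : Wq E abs na F,
      Nat.card {β : Wq E abs na F // pmulW E abs na F π hπ1.le β = γ} = q)
    -- `ψ` is an additive character of `F`, trivial on `O_F`, under which `O_F` is its own
    -- annihilator (in particular `ψ` is nontrivial on `π⁻¹O_F`):
    (ψ : F → E)
    (hψadd : ∀ x y : F, ψ (x + y) = ψ x * ψ y)
    (hψO : ∀ x : F, abs (x : E) ≤ 1 → ψ x = 1)
    (hψann : ∀ b : F, 1 < abs (b : E) → ∃ x : F, abs (x : E) ≤ 1 ∧ ψ (b * x) ≠ 1)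
    (c : Wq E abs na F → E)
    (hc : {β : Wq E abs na F | c β ≠ 0}.Finite) :
    (∀ x : F, abs (x : E) = 1 →
        (∑ᶠ β : Wq E abs na F, c β * ψ (Quotient.out β * x)) = 0) ↔
      (∀ β β' : Wq E abs na F,
        pmulW E abs na F π hπ1.le β = pmulW E abs na F π hπ1.le β' → c β = c β') := by
  have hπpos : 0 < abs (π : E) := abs.pos (by simpa using hπ0)
  constructor
  · intro h β β' hββ'
    obtain ⟨w, hw⟩ : ∃ w, w = β - β' := ⟨_, rfl⟩
    have hπw : abs ((π * Quotient.out w : F) : E) ≤ 1 := by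
      have h0 : pmulW E abs na F π hπ1.le w = 0 := by rw [hw, map_sub, hββ', sub_self]
      rw [← QuotientAddGroup.out_eq' w] at h0
      exact (QuotientAddGroup.eq_zero_iff _).1 h0
    have hcw : {β | c (β - w) ≠ 0}.Finite := hc.preimage sub_left_injective.injOn
    have key := eq_zero_of_finsum_mul_map_out_eq_zero (c := fun β ↦ c β - c (β - w))
      hψadd hψO hψann ((hc.union hcw).subset ?_) ?_ β
    · rw [hw, sub_sub_cancel] at key
      exact sub_eq_zero.1 key
    · intro γ hγ
      by_contra! hcon
      simp only [Set.mem_union, Set.mem_ofPred_eq, not_or, not_not] at hcon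
      exact hγ (by simp [hcon])
    · intro x hx
      simp only [sub_mul]
      rw [finsum_sub_distrib (hc.subset fun β h ↦ left_ne_zero_of_mul h)
        (hcw.subset fun β h ↦ left_ne_zero_of_mul h), finsum_sub_mul_map_out hψadd hψO c w hx]
      rcases hx.eq_or_lt with hx1 | hx1
      · rw [h x hx1, zero_mul, sub_zero]
      · have hxπ : abs (x : E) ≤ abs (π : E) := by
          rcases eq_or_ne x 0 with rfl | hx0
          · simp
          obtain ⟨k, hk⟩ := hdisc x hx0
          rw [hk] at hx1 ⊢
          have hk1 : 1 ≤ k := by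
            by_contra! hk0
            exact hx1.not_ge (one_le_zpow_of_nonpos₀ hπpos hπ1.le (by lia))
          simpa using zpow_le_zpow_right_of_le_one₀ hπpos hπ1.le hk1
        have hwx : abs ((Quotient.out w * x : F) : E) ≤ 1 := by
          rw [Subfield.coe_mul, abs.map_mul] at hπw ⊢
          calc _ ≤ abs ((Quotient.out w : F) : E) * abs (π : E) := by gcongr
            _ ≤ 1 := by rwa [mul_comm]
        rw [hψO _ hwx, mul_one, sub_self]
  · intro h x hx
    have hx0 : x ≠ 0 := by
      rintro rfl
      simp at hx
    obtain ⟨y, hy, hψy⟩ := hψann π⁻¹ (by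
      rw [Subfield.coe_inv, map_inv₀]
      exact (one_lt_inv₀ hπpos).2 hπ1)
    obtain ⟨w, hw⟩ : ∃ w : Wq E abs na F, w = ((π⁻¹ * y * x⁻¹ : F) : Wq E abs na F) := ⟨_, rfl⟩
    have hπw : pmulW E abs na F π hπ1.le w = 0 := by
      rw [hw]
      refine (QuotientAddGroup.eq_zero_iff _).2 ?_
      change abs ((π * (π⁻¹ * y * x⁻¹) : F) : E) ≤ 1
      rw [show π * (π⁻¹ * y * x⁻¹) = y * x⁻¹ by field_simp]
      simpa [hx] using hy
    have hψw : ψ (Quotient.out w * x) ≠ 1 := by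
      rwa [map_mul_eq_of_mk_eq (na := na) hψadd hψO
        ((QuotientAddGroup.out_eq' w).trans hw) hx.le, inv_mul_cancel_right₀ hx0]
    have key := finsum_sub_mul_map_out hψadd hψO c w hx.le
    rw [finsum_congr fun β ↦ by
      rw [h (β - w) β (by rw [map_sub, hπw, sub_zero])]] at key
    by_contra hS
    exact hψw (mul_left_cancel₀ hS (by rw [← key, mul_one]))

end BS
end
end

section
/- For every γ ∈ W and every l ∈ ℤ, the intersection ∩_{β∈W : πβ=γ} N_l(β) equals π^n N_{l+1}(γ). -/
open scoped Classical

noncomputable section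

namespace BS

variable (E : Type) [Field E]

/-- for every `γ ∈ W` and every `l ∈ ℤ`, the intersection
`∩_{β∈W : πβ=γ} N_l(β)` equals `π^n N_{l+1}(γ)` (Lemma 2.2(i) of the paper). -/
theorem stmt8 [CharZero E]
    (abs : AbsoluteValue E ℝ)
    (na : ∀ x y : E, abs (x + y) ≤ max (abs x) (abs y))
    (F : Subfield E) (π : F)
    (hπ0 : π ≠ 0) (hπ1 : abs (π : E) < 1)
    (hdisc : ∀ x : F, x ≠ 0 → ∃ k : ℤ, abs (x : E) = abs (π : E) ^ k)
    -- the residue field has `q` elements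
    (q : ℕ) (hq : 0 < q)
    (hcard : ∀ γ : Wq E abs na F,
      Nat.card {β : Wq E abs na F // pmulW E abs na F π hπ1.le β = γ} = q)
    (n : ℕ) :
    ∀ (γ : Wq E abs na F) (l : ℤ),
      {P : Polynomial E | ∀ β : Wq E abs na F,
          pmulW E abs na F π hπ1.le β = γ → P ∈ Nset E abs na F π n l β} =
        (fun P : Polynomial E => ((π : E) ^ n) • P) '' Nset E abs na F π n (l+1) γ := by
  intro γ l
  have hp : (π : E) ≠ 0 := by simpa using hπ0
  have ha : 0 < abs (π : E) := abs.pos hp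
  have hz : ((π ^ l : F) : E) = (π : E) ^ l := map_zpow₀ F.subtype π l
  have hexp : abs (π : E) ^ (-((n : ℤ) * l)) =
      abs (π : E) ^ n * abs (π : E) ^ (-((n : ℤ) * (l + 1))) := by
    rw [← zpow_natCast, ← zpow_add₀ ha.ne']
    congr 1
    ring
  ext P
  constructor
  · intro hP
    have hmem : ∀ b : F, mkW E abs na F (π * b) = γ → P ∈ Nset E abs na F π n l
        (mkW E abs na F b) := fun b hb => hP _ hb
    refine ⟨((π : E) ^ n)⁻¹ • P, ⟨?_, ?_⟩, smul_inv_smul₀ (pow_ne_zero n hp) P⟩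
    · obtain ⟨c, hc⟩ := QuotientAddGroup.mk'_surjective (OFadd E abs na F) γ
      refine (Polynomial.degree_smul_le _ _).trans (hmem (π⁻¹ * c) ?_).1
      rw [mul_inv_cancel_left₀ hπ0]
      exact hc
    · intro c hc u hu
      have hb : mkW E abs na F (π * (π ^ l * u)) = γ := by
        rw [← hc]
        refine (QuotientAddGroup.eq_iff_sub_mem (N := OFadd E abs na F)).2 ?_
        change abs (((π * (π ^ l * u) - c : F)) : E) ≤ 1
        have hc' : ((π * (π ^ l * u) - c : F) : E) =
            (π : E) ^ (l + 1) * ((u : E) - (π : E) ^ (-(l + 1)) * (c : E)) := by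
          push_cast
          rw [hz, mul_sub, ← mul_assoc _ _ (c : E), ← zpow_add₀ hp, add_neg_cancel, zpow_zero,
            one_mul, zpow_add_one₀ hp]
          ring
        rw [hc', abs.map_mul]
        refine (mul_le_mul_of_nonneg_left hu (abs.nonneg _)).trans ?_
        rw [← abs.map_mul, ← zpow_add₀ hp, add_neg_cancel, zpow_zero, abs.map_one]
      have hPu := (hmem _ hb).2 _ rfl u (by
        rw [Subfield.coe_mul, hz, ← mul_assoc, ← zpow_add₀ hp, neg_add_cancel, zpow_zero, one_mul, sub_self,
          abs.map_zero]
        exact abs.nonneg _)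
      rw [Polynomial.eval_smul, smul_eq_mul, abs.map_mul, map_inv₀, map_pow, inv_mul_le_iff₀ (pow_pos ha n),
        ← hexp]
      exact hPu
  · rintro ⟨Q, ⟨hdeg, hQ⟩, rfl⟩ β hβ
    refine ⟨(Polynomial.degree_smul_le _ _).trans hdeg, ?_⟩
    rintro b rfl u hu
    have hc : (π : E) ^ (-(l + 1)) * ((π * b : F) : E) = (π : E) ^ (-l) * (b : E) := by
      push_cast
      rw [← mul_assoc, ← zpow_add_one₀ hp]
      congr 2
      ring
    have hQu := hQ (π * b) hβ u (by
      rw [hc]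
      refine hu.trans ?_
      rw [map_zpow₀, map_zpow₀]
      exact zpow_le_zpow_right_of_le_one₀ ha hπ1.le (by lia))
    rw [Polynomial.eval_smul, smul_eq_mul, abs.map_mul, map_pow, hexp]
    exact mul_le_mul_of_nonneg_left hQu (by positivity)

end BS
end
end

section
/- Assume n < q. Then for every β ∈ W and l ∈ ℤ, N_l(β) ⊆ N_{l+1}(πβ). -/
open scoped Classical

noncomputable section

namespace BS

variable (E : Type) [Field E]

/-- Ultrametric maximum principle for finite sums. -/
theorem abs_sum_le_of_forall_le {E : Type} [Field E] (abs : AbsoluteValue E ℝ)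
    (na : ∀ x y : E, abs (x + y) ≤ max (abs x) (abs y))
    {ι : Type*} (s : Finset ι) (f : ι → E) {A : ℝ} (hA : 0 ≤ A)
    (h : ∀ i ∈ s, abs (f i) ≤ A) : abs (∑ i ∈ s, f i) ≤ A :=
  Finset.sum_induction f (fun x => abs x ≤ A)
    (fun x y hx hy => (na x y).trans (max_le hx hy)) (by simpa using hA) h

/-- Lagrange interpolation bound: a polynomial of degree `< #s` bounded by `A` on `δ`-separated
nodes is bounded by `A * R ^ (#s - 1)` at any point at distance at most `R * δ` from the nodes. -/
theorem abs_eval_le_of_separated_nodes {E : Type} [Field E] (abs : AbsoluteValue E ℝ)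
    (na : ∀ x y : E, abs (x + y) ≤ max (abs x) (abs y))
    {ι : Type*} (s : Finset ι) (v : ι → E) (P : Polynomial E)
    (hP : P.degree < s.card) {A R δ : ℝ} (hA : 0 ≤ A) (hR : 0 ≤ R) (hδ : 0 < δ)
    (hsep : ∀ i ∈ s, ∀ j ∈ s, i ≠ j → δ ≤ abs (v i - v j))
    (hPv : ∀ i ∈ s, abs (P.eval (v i)) ≤ A) (x : E)
    (hx : ∀ i ∈ s, abs (x - v i) ≤ R * δ) :
    abs (P.eval x) ≤ A * R ^ (s.card - 1) := by
  have hinj : Set.InjOn v s := by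
    intro i hi j hj hij
    by_contra hne
    have h := hsep i hi j hj hne
    rw [hij, sub_self, abs.map_zero] at h
    exact absurd hδ h.not_gt
  rw [Lagrange.eq_interpolate hinj hP, Lagrange.interpolate_apply, Polynomial.eval_finsetSum]
  refine abs_sum_le_of_forall_le abs na s _ (by positivity) fun i hi => ?_
  rw [Polynomial.eval_mul, Polynomial.eval_C, abs.map_mul]
  refine mul_le_mul (hPv i hi) ?_ (abs.nonneg _) hA
  rw [Lagrange.basis, Polynomial.eval_prod, map_prod, ← Finset.card_erase_of_mem hi]
  rw [← Finset.prod_const]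
  refine Finset.prod_le_prod (fun j _ => abs.nonneg _) fun j hj => ?_
  obtain ⟨hne, hjs⟩ := Finset.mem_erase.mp hj
  have hs := hsep i hi j hjs hne.symm
  simp only [Lagrange.basisDivisor, Polynomial.eval_mul, Polynomial.eval_C, Polynomial.eval_sub,
    Polynomial.eval_X, abs.map_mul, map_inv₀]
  rw [inv_mul_le_iff₀ (hδ.trans_le hs), mul_comm]
  exact (hx j hjs).trans (mul_le_mul_of_nonneg_left hs hR)

theorem mkW_eq_iff (abs : AbsoluteValue E ℝ)
    (na : ∀ x y : E, abs (x + y) ≤ max (abs x) (abs y)) (F : Subfield E) (a b : F) :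
    mkW E abs na F a = mkW E abs na F b ↔ abs ((a : E) - b) ≤ 1 := by
  rw [eq_comm]
  refine QuotientAddGroup.eq.trans ?_
  rw [neg_add_eq_sub]
  rfl

/-- assume `n < q`.  Then for every `β ∈ W` and `l ∈ ℤ`,
`N_l(β) ⊆ N_{l+1}(πβ)` (Lemma 2.2(iii) of the paper). -/
theorem stmt10 [CharZero E]
    (abs : AbsoluteValue E ℝ)
    (na : ∀ x y : E, abs (x + y) ≤ max (abs x) (abs y))
    (F : Subfield E) (π : F)
    (hπ0 : π ≠ 0) (hπ1 : abs (π : E) < 1)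
    (hdisc : ∀ x : F, x ≠ 0 → ∃ k : ℤ, abs (x : E) = abs (π : E) ^ k)
    -- the residue field has `q` elements
    (q : ℕ) (hq : 0 < q)
    (hcard : ∀ γ : Wq E abs na F,
      Nat.card {β : Wq E abs na F // pmulW E abs na F π hπ1.le β = γ} = q)
    (n : ℕ) (hn : n < q) :
    ∀ (β : Wq E abs na F) (l : ℤ),
      Nset E abs na F π n l β ⊆
        Nset E abs na F π n (l+1) (pmulW E abs na F π hπ1.le β) := by
  rintro β l P ⟨hdeg, hP⟩
  refine ⟨hdeg, fun b hb u hu => ?_⟩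
  obtain ⟨b₀, rfl⟩ : ∃ b₀, mkW E abs na F b₀ = β := QuotientAddGroup.mk'_surjective _ β
  have hπE : (π : E) ≠ 0 := by simpa using hπ0
  have hr : 0 < abs (π : E) := abs.pos hπE
  have hb' : abs ((b : E) - π * b₀) ≤ 1 := by
    simpa using (mkW_eq_iff E abs na F b (π * b₀)).mp hb
  set K := {γ : Wq E abs na F // pmulW E abs na F π hπ1.le γ = 0}
  have hK : Nat.card K = q := hcard 0
  have : Finite K := Nat.finite_of_card_ne_zero (by omega)
  have := Fintype.ofFinite K
  obtain ⟨s, -, hs⟩ := Finset.exists_subset_card_eq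
    (s := (Finset.univ : Finset K)) (n := n + 1)
    (by rw [Finset.card_univ, ← Nat.card_eq_fintype_card, hK]; omega)
  choose c hc using fun γ : K => QuotientAddGroup.mk'_surjective (OFadd E abs na F) γ.1
  replace hc : ∀ γ, mkW E abs na F (c γ) = γ.1 := hc
  have hcπ : ∀ γ, abs ((π : E) * c γ) ≤ 1 := fun γ => by
    have h : mkW E abs na F (π * c γ) = mkW E abs na F 0 := by
      rw [map_zero, ← γ.2, ← hc γ]
      rfl
    simpa using (mkW_eq_iff E abs na F _ _).mp h
  have hcsep : ∀ γ γ', γ ≠ γ' → 1 ≤ abs ((π : E) * (c γ - c γ')) := fun γ γ' hne => by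
    have h1 : 1 < abs ((c γ : E) - c γ') := by
      by_contra! h
      exact hne (Subtype.ext (by rw [← hc γ, ← hc γ', (mkW_eq_iff E abs na F _ _).mpr h]))
    obtain ⟨k, hk⟩ := hdisc (c γ - c γ') (by
      intro h
      have h' : (c γ : E) - c γ' = 0 := by exact_mod_cast congrArg Subtype.val h
      rw [h', abs.map_zero] at h1
      linarith)
    rw [AddSubgroupClass.coe_sub] at hk
    rw [hk] at h1
    have hk0 : k < 0 := by
      by_contra! h
      exact absurd h1 (zpow_le_one₀ hr hπ1.le h).not_gt
    rw [abs.map_mul, hk, ← zpow_one_add₀ hr.ne']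
    exact one_le_zpow_of_nonpos₀ hr hπ1.le (by omega)
  set v : K → F := fun γ => π ^ (-l) * (b₀ + π * c γ) with hv
  have hvE : ∀ γ, (v γ : E) = (π : E) ^ (-l) * (b₀ + π * c γ) := fun γ => by
    have hz : ((π ^ (-l) : F) : E) = (π : E) ^ (-l) := map_zpow₀ F.subtype π (-l)
    simp only [hv, Subfield.coe_mul, Subfield.coe_add, hz]
  have hzl : 0 < abs (π : E) ^ (-l) := zpow_pos hr _
  have key := abs_eval_le_of_separated_nodes abs na s (fun γ => (v γ : E)) P
    (by rw [hs]; exact hdeg.trans_lt (by exact_mod_cast n.lt_succ_self))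
    (A := abs (π : E) ^ (-((n : ℤ) * l))) (R := (abs (π : E))⁻¹) (δ := abs (π : E) ^ (-l))
    (by positivity) (by positivity) hzl
    (fun i _ j _ hij => by
      have h : (v i : E) - v j = (π : E) ^ (-l) * (π * (c i - c j)) := by
        rw [hvE, hvE]; ring
      rw [h, abs.map_mul, map_zpow₀]
      exact le_mul_of_one_le_right hzl.le (hcsep i j hij))
    (fun i _ => by
      refine hP b₀ rfl (v i) ?_
      have h : (v i : E) - (π : E) ^ (-l) * b₀ = (π : E) ^ (-l) * (π * c i) := by
        rw [hvE]; ring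
      rw [h, abs.map_mul]
      exact mul_le_of_le_one_right (abs.nonneg _) (hcπ i))
    (u : E)
    (fun i _ => by
      have hz : (π : E) ^ (-l) = (π : E) ^ (-(l + 1)) * π := by
        rw [← zpow_add_one₀ hπE]; congr 1; ring
      have hzr : (abs (π : E))⁻¹ * abs (π : E) ^ (-l) = abs ((π : E) ^ (-(l + 1))) := by
        rw [← map_zpow₀, hz, abs.map_mul]
        field_simp
      have h : (u : E) - v i = (u - (π : E) ^ (-(l + 1)) * b) +
          (π : E) ^ (-(l + 1)) * ((b - π * b₀) + -(π * (π * c i))) := by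
        rw [hvE, hz]; ring
      rw [hzr, h]
      refine (na _ _).trans (max_le hu ?_)
      rw [abs.map_mul]
      refine mul_le_of_le_one_right (abs.nonneg _) ((na _ _).trans (max_le hb' ?_))
      rw [abs.map_neg, abs.map_mul]
      exact mul_le_one₀ hπ1.le (abs.nonneg _) (hcπ i))
  refine key.trans_eq ?_
  rw [hs, Nat.add_sub_cancel, inv_pow, ← zpow_natCast, ← zpow_neg, ← zpow_add₀ hr.ne']
  congr 1
  ring

end BS
end
end
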